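/- arXiv:2510.17743 — 5 statements merged into one kernel-verified Lean document; each statement's English description precedes it below -/
import Mathlib

section
/- Let n be a positive integer and let m be a real number with 10^36 ≤ m ≤ n. Then there exists an ((m+1)/n)-spread probability distribution over subsets of [n]² supported on m-nice sets. -/
open Set

noncomputable section

/-- The grid `[n]² = {1,…,n}²` regarded as a subset of `ℝ²`. -/
def grid2 (n : ℕ) : Set (ℝ × ℝ) :=
  {p | ∃ a b : ℤ, 1 ≤ a ∧ a ≤ (n : ℤ) ∧ 1 ≤ b ∧ b ≤ (n : ℤ) ∧ p = ((a : ℝ), (b : ℝ))}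

/-- An (affine) line in `ℝ²`: a one-dimensional affine subspace of `ℝ²`. -/
def IsLine (L : AffineSubspace ℝ (ℝ × ℝ)) : Prop :=
  Module.finrank ℝ L.direction = 1

/-- Membership in `𝓛`: lines intersecting the grid `[n]²` in at least two points. -/
def InLines (n : ℕ) (L : AffineSubspace ℝ (ℝ × ℝ)) : Prop :=
  IsLine L ∧ 2 ≤ (grid2 n ∩ (L : Set (ℝ × ℝ))).ncard

/-- The weight `w(L) = |[n]² ∩ L| / n` of a line `L`. -/
def lineWeight (n : ℕ) (L : AffineSubspace ℝ (ℝ × ℝ)) : ℝ :=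
  ((grid2 n ∩ (L : Set (ℝ × ℝ))).ncard : ℝ) / n

/-- The subset of `ℝ²` corresponding to `I × J` for sets `I, J ⊆ {1,…,n}` of integers. -/
def gridRect (I J : Finset ℤ) : Set (ℝ × ℝ) :=
  {p | ∃ a ∈ I, ∃ b ∈ J, p = ((a : ℝ), (b : ℝ))}

/-- A set `S ⊆ [n]²` is `m`-nice. -/
def IsNice (n : ℕ) (m : ℝ) (S : Set (ℝ × ℝ)) : Prop :=
  S ⊆ grid2 n ∧
  -- (1) concentration for heavy lines
  (∀ L : AffineSubspace ℝ (ℝ × ℝ), InLines n L →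
    m ^ (-(2 : ℝ)/3) < lineWeight n L → lineWeight n L ≤ 1 →
    (1 - m ^ (-(1 : ℝ)/12)) * m * lineWeight n L ≤ ((S ∩ (L : Set (ℝ × ℝ))).ncard : ℝ) ∧
    ((S ∩ (L : Set (ℝ × ℝ))).ncard : ℝ) ≤ (1 + m ^ (-(1 : ℝ)/12)) * m * lineWeight n L) ∧
  -- (2) upper bound for medium lines
  (∀ L : AffineSubspace ℝ (ℝ × ℝ), InLines n L →
    m ^ (-(2 : ℝ)) < lineWeight n L → lineWeight n L ≤ m ^ (-(2 : ℝ)/3) →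
    ((S ∩ (L : Set (ℝ × ℝ))).ncard : ℝ) ≤ (1 + m ^ (-(1 : ℝ)/12)) * m ^ ((1 : ℝ)/3)) ∧
  -- (3) very few points on light lines
  (∀ L : AffineSubspace ℝ (ℝ × ℝ), InLines n L →
    lineWeight n L ≤ m ^ (-(2 : ℝ)) →
    (S ∩ (L : Set (ℝ × ℝ))).ncard ≤ 14) ∧
  -- (4) quasirandomness
  (∀ I J : Finset ℤ, ↑I ⊆ Set.Icc (1 : ℤ) (n : ℤ) → ↑J ⊆ Set.Icc (1 : ℤ) (n : ℤ) →
    (n : ℝ)/10 ≤ I.card → (n : ℝ)/10 ≤ J.card →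
    (1 - m ^ (-(1 : ℝ)/12)) * I.card * J.card * m / n ≤ ((S ∩ gridRect I J).ncard : ℝ) ∧
    ((S ∩ gridRect I J).ncard : ℝ) ≤ (1 + m ^ (-(1 : ℝ)/12)) * I.card * J.card * m / n)

/-- A probability distribution over subsets of `[n]²` is `p`-spread if
`ℙ[T ⊆ S] ≤ p^|T|` for every `T ⊆ [n]²`. -/
def IsSpread (n : ℕ) (p : ℝ) (μ : PMF (Finset (ℝ × ℝ))) : Prop :=
  ∀ T : Finset (ℝ × ℝ), ↑T ⊆ grid2 n →
    (μ.toOuterMeasure {S | T ⊆ S}).toReal ≤ p ^ T.card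

/-- A distribution is supported on `m`-nice sets. -/
def SupportedOnNice (n : ℕ) (m : ℝ) (μ : PMF (Finset (ℝ × ℝ))) : Prop :=
  ∀ S : Finset (ℝ × ℝ), μ S ≠ 0 → IsNice n m ↑S

section BinomialSubset

variable {α : Type*} [DecidableEq α]

/-- Expectation of `f` at a random subset of `V` containing each point independently with
probability `q`. -/
def subsetExp (q : ℝ) (V : Finset α) (f : Finset α → ℝ) : ℝ :=
  ∑ S ∈ V.powerset, q ^ S.card * (1 - q) ^ (V \ S).card * f S

/-- Probability that a random subset of `V` (with density `q`) lies in `E`. -/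
def subsetProb (q : ℝ) (V : Finset α) (E : Set (Finset α)) : ℝ :=
  subsetExp q V (E.indicator 1)

lemma subsetExp_split (q : ℝ) {D V : Finset α} (hD : D ⊆ V) (f g : Finset α → ℝ) :
    subsetExp q V (fun S => f (S ∩ D) * g (S \ D)) = subsetExp q D f * subsetExp q (V \ D) g := by
  unfold subsetExp
  rw [Finset.sum_mul_sum, ← Finset.sum_product']
  symm
  refine Finset.sum_nbij' (fun P => P.1 ∪ P.2) (fun S => (S ∩ D, S \ D)) ?_ ?_ ?_ ?_ ?_
  · rintro ⟨a, b⟩ h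
    simp only [Finset.mem_product, Finset.mem_powerset] at h ⊢
    exact Finset.union_subset (h.1.trans hD) (h.2.trans Finset.sdiff_subset)
  · intro S h
    simp only [Finset.mem_product, Finset.mem_powerset] at h ⊢
    exact ⟨Finset.inter_subset_right, Finset.sdiff_subset_sdiff h subset_rfl⟩
  · rintro ⟨a, b⟩ h
    simp only [Finset.mem_product, Finset.mem_powerset] at h
    ext x <;> have h1 := @h.1 x <;> have h2 := @h.2 x <;> simp at h2 ⊢ <;> tauto
  · intro S h
    ext x
    simp
    tauto
  · rintro ⟨a, b⟩ h
    simp only [Finset.mem_product, Finset.mem_powerset] at h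
    have e1 : (a ∪ b) ∩ D = a := by
      ext x; have h1 := @h.1 x; have h2 := @h.2 x; simp at h2 ⊢; tauto
    have e2 : (a ∪ b) \ D = b := by
      ext x; have h1 := @h.1 x; have h2 := @h.2 x; simp at h2 ⊢; tauto
    have d1 : Disjoint a b := by
      rw [Finset.disjoint_left]
      intro x hx hx'
      exact (Finset.mem_sdiff.1 (h.2 hx')).2 (h.1 hx)
    have e3 : V \ (a ∪ b) = (D \ a) ∪ ((V \ D) \ b) := by
      ext x; have h1 := @h.1 x; have h2 := @h.2 x; have h3 := @hD x; simp at h2 ⊢; tauto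
    have d2 : Disjoint (D \ a) ((V \ D) \ b) := by
      rw [Finset.disjoint_left]
      intro x hx hx'
      simp at hx hx'
      tauto
    simp only [e1, e2, e3, Finset.card_union_of_disjoint d1, Finset.card_union_of_disjoint d2,
      pow_add]
    ring

lemma subsetExp_one (q : ℝ) (V : Finset α) : subsetExp q V (fun _ => 1) = 1 := by
  unfold subsetExp
  have := Finset.sum_pow_mul_eq_add_pow q (1 - q) V
  rw [add_sub_cancel, one_pow] at this
  refine Eq.trans (Finset.sum_congr rfl fun S hS => ?_) this
  rw [mul_one, Finset.card_sdiff_of_subset (Finset.mem_powerset.1 hS)]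

lemma subsetExp_inter (q : ℝ) {D V : Finset α} (hD : D ⊆ V) (f : Finset α → ℝ) :
    subsetExp q V (fun S => f (S ∩ D)) = subsetExp q D f := by
  have := subsetExp_split q hD f (fun _ => 1)
  simpa [subsetExp_one] using this

lemma subsetExp_mono {q : ℝ} (h0 : 0 ≤ q) (h1 : q ≤ 1) {V : Finset α} {f g : Finset α → ℝ}
    (h : ∀ S ⊆ V, f S ≤ g S) : subsetExp q V f ≤ subsetExp q V g := by
  refine Finset.sum_le_sum fun S hS => ?_
  have : 0 ≤ 1 - q := by linarith
  have := h S (Finset.mem_powerset.1 hS)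
  gcongr

lemma subsetExp_congr {q : ℝ} {V : Finset α} {f g : Finset α → ℝ}
    (h : ∀ S ⊆ V, f S = g S) : subsetExp q V f = subsetExp q V g :=
  Finset.sum_congr rfl fun S hS => by rw [h S (Finset.mem_powerset.1 hS)]

lemma subsetExp_const_mul (q : ℝ) (V : Finset α) (c : ℝ) (f : Finset α → ℝ) :
    subsetExp q V (fun S => c * f S) = c * subsetExp q V f := by
  simp only [subsetExp, Finset.mul_sum]
  exact Finset.sum_congr rfl fun S _ => by ring

lemma subsetProb_nonneg {q : ℝ} (h0 : 0 ≤ q) (h1 : q ≤ 1) (V : Finset α)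
    (E : Set (Finset α)) : 0 ≤ subsetProb q V E := by
  have := subsetExp_mono h0 h1 (V := V) (f := fun _ => 0) (g := E.indicator 1)
    (fun S _ => indicator_nonneg (fun _ _ => zero_le_one) S)
  simpa [subsetExp, subsetProb] using this

lemma subsetProb_mono {q : ℝ} (h0 : 0 ≤ q) (h1 : q ≤ 1) {V : Finset α}
    {E F : Set (Finset α)} (h : ∀ S ⊆ V, S ∈ E → S ∈ F) :
    subsetProb q V E ≤ subsetProb q V F := by
  refine subsetExp_mono h0 h1 fun S hS => ?_
  by_cases hE : S ∈ E
  · simp [hE, h S hS hE]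
  · simp only [hE, not_false_eq_true, indicator_of_notMem]
    exact indicator_nonneg (fun _ _ => zero_le_one) S

lemma subsetProb_univ (q : ℝ) (V : Finset α) : subsetProb q V univ = 1 := by
  have : (univ : Set (Finset α)).indicator (1 : Finset α → ℝ) = fun _ => 1 := by
    ext; simp
  rw [subsetProb, this, subsetExp_one]

lemma subsetProb_inter_add_diff (q : ℝ) (V : Finset α) (E F : Set (Finset α)) :
    subsetProb q V (E ∩ F) + subsetProb q V (E \ F) = subsetProb q V E := by
  simp only [subsetProb, subsetExp, ← Finset.sum_add_distrib]
  refine Finset.sum_congr rfl fun S _ => ?_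
  by_cases h : S ∈ E <;> by_cases h' : S ∈ F <;> simp [h, h']

lemma subsetProb_biUnion_le {q : ℝ} (h0 : 0 ≤ q) (h1 : q ≤ 1) (V : Finset α) {ι : Type*}
    (I : Finset ι) (E : ι → Set (Finset α)) :
    subsetProb q V (⋃ i ∈ I, E i) ≤ ∑ i ∈ I, subsetProb q V (E i) := by
  have : ∑ i ∈ I, subsetProb q V (E i)
      = subsetExp q V (fun S => ∑ i ∈ I, (E i).indicator 1 S) := by
    simp only [subsetProb, subsetExp, Finset.mul_sum]
    exact Finset.sum_comm
  rw [this]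
  refine subsetExp_mono h0 h1 fun S _ => ?_
  have hn : ∀ i ∈ I, 0 ≤ (E i).indicator (1 : Finset α → ℝ) S := fun i _ =>
    indicator_nonneg (fun _ _ => zero_le_one) S
  by_cases h : S ∈ ⋃ i ∈ I, E i
  · simp only [mem_iUnion] at h
    obtain ⟨i, hi, hS⟩ := h
    have h2 := Finset.single_le_sum hn hi
    rw [indicator_of_mem hS] at h2
    rwa [indicator_of_mem (by simp only [mem_iUnion]; exact ⟨i, hi, hS⟩)]
  · rw [indicator_of_notMem h]
    exact Finset.sum_nonneg hn

lemma subsetProb_union_le {q : ℝ} (h0 : 0 ≤ q) (h1 : q ≤ 1) (V : Finset α)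
    (E F : Set (Finset α)) :
    subsetProb q V (E ∪ F) ≤ subsetProb q V E + subsetProb q V F := by
  have h := subsetProb_inter_add_diff q V (E ∪ F) F
  have h2 : subsetProb q V ((E ∪ F) ∩ F) ≤ subsetProb q V F :=
    subsetProb_mono h0 h1 fun S _ hS => hS.2
  have h3 : subsetProb q V ((E ∪ F) \ F) ≤ subsetProb q V E :=
    subsetProb_mono h0 h1 fun S _ hS => hS.1.resolve_right hS.2
  linarith

/-- Events determined by disjoint sets of points are independent. -/
lemma subsetProb_inter_eq_mul (q : ℝ) {D V : Finset α} (hD : D ⊆ V) {E F : Set (Finset α)}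
    (hE : ∀ S, S ∈ E ↔ S ∩ D ∈ E) (hF : ∀ S, S ∈ F ↔ S \ D ∈ F) :
    subsetProb q V (E ∩ F) = subsetProb q V E * subsetProb q V F := by
  have e1 := subsetExp_split q hD (E.indicator 1) (F.indicator 1)
  have e2 := subsetExp_split q hD (E.indicator 1) (fun _ => 1)
  have e3 := subsetExp_split q hD (fun _ => 1) (F.indicator 1)
  have iE : ∀ S, E.indicator (1 : Finset α → ℝ) (S ∩ D) = E.indicator 1 S := fun S => by
    by_cases h : S ∈ E
    · rw [indicator_of_mem h, indicator_of_mem ((hE S).1 h)]; rfl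
    · rw [indicator_of_notMem h, indicator_of_notMem (mt (hE S).2 h)]
  have iF : ∀ S, F.indicator (1 : Finset α → ℝ) (S \ D) = F.indicator 1 S := fun S => by
    by_cases h : S ∈ F
    · rw [indicator_of_mem h, indicator_of_mem ((hF S).1 h)]; rfl
    · rw [indicator_of_notMem h, indicator_of_notMem (mt (hF S).2 h)]
  simp only [subsetExp_one, mul_one, one_mul, iE, iF] at e1 e2 e3
  unfold subsetProb
  rw [inter_indicator_one, e2, e3, ← e1]
  rfl

lemma subsetProb_superset (q : ℝ) {T V : Finset α} (hT : T ⊆ V) :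
    subsetProb q V {S | T ⊆ S} = q ^ T.card := by
  have h := subsetExp_inter q hT (({S | T ⊆ S} : Set (Finset α)).indicator 1)
  have e : subsetProb q V {S | T ⊆ S}
      = subsetExp q V (fun S => ({S | T ⊆ S} : Set (Finset α)).indicator 1 (S ∩ T)) := by
    refine subsetExp_congr fun S _ => ?_
    have : T ⊆ S ↔ T ⊆ S ∩ T := by rw [Finset.subset_inter_iff]; simp
    by_cases h : T ⊆ S
    · rw [indicator_of_mem (by exact h), indicator_of_mem (by exact this.1 h)]; rfl
    · rw [indicator_of_notMem (by exact h), indicator_of_notMem (by exact fun h' => h (this.2 h'))]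
  rw [e, h, subsetExp, Finset.sum_eq_single T]
  · simp
  · intro S hS hne
    rw [indicator_of_notMem, mul_zero]
    intro h
    exact hne (subset_antisymm (Finset.mem_powerset.1 hS) h)
  · simp

lemma subsetProb_le_exp_of_card_ge {q : ℝ} (h0 : 0 ≤ q) (h1 : q ≤ 1) {D V : Finset α}
    (hD : D ⊆ V) (a l : ℝ) (E : Set (Finset α))
    (hE : ∀ S ∈ E, a ≤ l * (S ∩ D).card) (hl : |l| ≤ 1) :
    subsetProb q V E ≤ Real.exp (q * D.card * (l + l ^ 2) - a) := by
  have h2 : subsetProb q V E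
      ≤ subsetExp q V (fun S => Real.exp (-a) * Real.exp l ^ (S ∩ D).card) := by
    refine subsetExp_mono h0 h1 fun S _ => ?_
    by_cases h : S ∈ E
    · rw [indicator_of_mem h, ← Real.exp_nat_mul, ← Real.exp_add]
      have := hE S h
      exact Real.one_le_exp (by linarith)
    · rw [indicator_of_notMem h]
      positivity
  have h3 : subsetExp q D (fun S => Real.exp l ^ S.card) = (q * Real.exp l + (1 - q)) ^ D.card := by
    rw [← Finset.sum_pow_mul_eq_add_pow]
    refine Finset.sum_congr rfl fun S hS => ?_
    rw [Finset.card_sdiff_of_subset (Finset.mem_powerset.1 hS), mul_pow]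
    ring
  rw [subsetExp_const_mul, subsetExp_inter q hD (fun S => Real.exp l ^ S.card), h3] at h2
  refine h2.trans ?_
  have h4 : q * Real.exp l + (1 - q) ≤ Real.exp (q * (l + l ^ 2)) := by
    have h5 := (abs_le.1 (Real.abs_exp_sub_one_sub_id_le hl)).2
    have h6 := Real.add_one_le_exp (q * (l + l ^ 2))
    nlinarith
  have h7 : 0 ≤ q * Real.exp l + (1 - q) := by
    have := Real.exp_pos l
    have : 0 ≤ 1 - q := by linarith
    positivity
  calc _ ≤ Real.exp (-a) * Real.exp (q * (l + l ^ 2)) ^ D.card := by gcongr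
    _ = _ := by rw [← Real.exp_nat_mul, ← Real.exp_add]; congr 1; ring

/-- Chernoff bound, upper tail. -/
lemma subsetProb_upper_tail {q : ℝ} (h0 : 0 ≤ q) (h1 : q ≤ 1) {D V : Finset α} (hD : D ⊆ V)
    {U t : ℝ} (hU : q * D.card ≤ U) (ht0 : 0 ≤ t) (ht1 : t ≤ 1) (E : Set (Finset α))
    (hE : ∀ S ∈ E, (1 + t) * U ≤ (S ∩ D).card) :
    subsetProb q V E ≤ Real.exp (-(U * t ^ 2 / 4)) := by
  refine (subsetProb_le_exp_of_card_ge h0 h1 hD (t / 2 * ((1 + t) * U)) (t / 2) E ?_ ?_).trans ?_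
  · intro S hS
    have := hE S hS
    gcongr
  · rw [abs_of_nonneg (by positivity)]; linarith
  · apply Real.exp_le_exp.2
    have : q * D.card * (t / 2 + (t / 2) ^ 2) ≤ U * (t / 2 + (t / 2) ^ 2) := by gcongr
    nlinarith

/-- Chernoff bound, lower tail. -/
lemma subsetProb_lower_tail {q : ℝ} (h0 : 0 ≤ q) (h1 : q ≤ 1) {D V : Finset α} (hD : D ⊆ V)
    {U t : ℝ} (hU : U ≤ q * D.card) (ht0 : 0 ≤ t) (ht1 : t ≤ 1) (E : Set (Finset α))
    (hE : ∀ S ∈ E, ((S ∩ D).card : ℝ) ≤ (1 - t) * U) :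
    subsetProb q V E ≤ Real.exp (-(U * t ^ 2 / 4)) := by
  refine (subsetProb_le_exp_of_card_ge h0 h1 hD (-(t / 2 * ((1 - t) * U))) (-(t / 2)) E ?_ ?_).trans
    ?_
  · intro S hS
    have := hE S hS
    have : t / 2 * ((S ∩ D).card : ℝ) ≤ t / 2 * ((1 - t) * U) := by gcongr
    linarith
  · rw [abs_neg, abs_of_nonneg (by positivity)]; linarith
  · apply Real.exp_le_exp.2
    have h3 : 0 ≤ t / 2 - (t / 2) ^ 2 := by nlinarith
    have : U * (t / 2 - (t / 2) ^ 2) ≤ q * D.card * (t / 2 - (t / 2) ^ 2) := by gcongr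
    nlinarith

lemma subsetProb_card_ge_le {q : ℝ} (h0 : 0 ≤ q) (h1 : q ≤ 1) {D V : Finset α} (hD : D ⊆ V)
    (r : ℕ) :
    subsetProb q V {S | r ≤ (S ∩ D).card} ≤ (q * D.card) ^ r / r.factorial := by
  have h2 : subsetProb q V {S | r ≤ (S ∩ D).card}
      ≤ subsetProb q V (⋃ T ∈ D.powersetCard r, {S | T ⊆ S}) := by
    refine subsetProb_mono h0 h1 fun S _ hS => ?_
    obtain ⟨T, hT, hc⟩ := Finset.exists_subset_card_eq (show r ≤ (S ∩ D).card from hS)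
    simp only [mem_iUnion, Finset.mem_powersetCard]
    exact ⟨T, ⟨hT.trans Finset.inter_subset_right, hc⟩, hT.trans Finset.inter_subset_left⟩
  refine h2.trans ((subsetProb_biUnion_le h0 h1 _ _ _).trans ?_)
  have h3 : ∀ T ∈ D.powersetCard r, subsetProb q V {S | T ⊆ S} = q ^ r := by
    intro T hT
    rw [Finset.mem_powersetCard] at hT
    rw [subsetProb_superset q (hT.1.trans hD), hT.2]
  rw [Finset.sum_congr rfl h3, Finset.sum_const, Finset.card_powersetCard, nsmul_eq_mul, mul_pow,
    mul_div_assoc, mul_comm]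
  gcongr
  exact Nat.choose_le_pow_div r D.card

section LocalLemma

variable {ι : Type*} [DecidableEq ι] {q x : ℝ} {V : Finset α} {I : Finset ι} {D : ι → Finset α}
  {A : ι → Set (Finset α)}

/-- The event that none of the events `A i`, `i ∈ J`, occurs. -/
def avoid (A : ι → Set (Finset α)) (J : Finset ι) : Set (Finset α) := {S | ∀ i ∈ J, S ∉ A i}

/-- Events with index in `J` whose domain meets `E`. -/
def touching (D : ι → Finset α) (J : Finset ι) (E : Finset α) : Finset ι :=
  J.filter fun j => ¬ Disjoint E (D j)

lemma subsetProb_inter_avoid_untouched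
    (hA : ∀ i ∈ I, ∀ S, S ∈ A i ↔ S ∩ D i ∈ A i) {J : Finset ι} (hJ : J ⊆ I)
    {C : Finset α} (hC : C ⊆ V) {E : Set (Finset α)} (hE : ∀ S, S ∈ E ↔ S ∩ C ∈ E) :
    subsetProb q V (E ∩ avoid A (J \ touching D J C))
      = subsetProb q V E * subsetProb q V (avoid A (J \ touching D J C)) := by
  refine subsetProb_inter_eq_mul q hC hE fun S => ?_
  refine forall₂_congr fun i hi => not_congr ?_
  simp only [touching, Finset.mem_sdiff, Finset.mem_filter, not_and, not_not] at hi
  have hd := hi.2 hi.1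
  rw [hA i (hJ hi.1) S, hA i (hJ hi.1) (S \ C)]
  have : (S \ C) ∩ D i = S ∩ D i := by
    ext y
    have : y ∈ C → y ∉ D i := fun h => Finset.disjoint_left.1 hd h
    simp; tauto
  rw [this]

lemma avoid_chain (hx1 : x ≤ 1) {J K : Finset ι} (hKJ : K ⊆ J) 
    (h : ∀ J' ⊂ J, ∀ i ∈ J, subsetProb q V (A i ∩ avoid A J') ≤ x * subsetProb q V (avoid A J')) :
    (1 - x) ^ K.card * subsetProb q V (avoid A (J \ K)) ≤ subsetProb q V (avoid A J) := by
  induction K using Finset.induction_on with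
  | empty => simp
  | insert i K hi ih =>
    have hiJ : i ∈ J := hKJ (Finset.mem_insert_self i K)
    specialize ih ((Finset.subset_insert i K).trans hKJ)
    refine le_trans ?_ ih
    rw [Finset.card_insert_of_notMem hi, pow_succ, mul_assoc]
    have hx : 0 ≤ 1 - x := by linarith
    gcongr
    have hlt : J \ insert i K ⊂ J := by
      refine Finset.ssubset_iff_subset_ne.2 ⟨Finset.sdiff_subset, fun h => ?_⟩
      rw [← h] at hiJ
      simp at hiJ
    have h2 := h _ hlt i hiJ
    have h3 := subsetProb_inter_add_diff q V (avoid A (J \ insert i K)) (A i)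
    have h4 : avoid A (J \ insert i K) \ A i = avoid A (J \ K) := by
      ext S
      simp only [avoid, mem_sdiff, mem_ofPred_eq, Finset.mem_sdiff, Finset.mem_insert, not_or]
      constructor
      · rintro ⟨h1, h2⟩ j hj
        by_cases hji : j = i
        · rwa [hji]
        · exact h1 j ⟨hj.1, hji, hj.2⟩
      · intro h1
        exact ⟨fun j hj => h1 j ⟨hj.1, hj.2.2⟩, h1 i ⟨hiJ, hi⟩⟩
    rw [h4, inter_comm] at h3
    linarith

/-- The (symmetric) Lovász local lemma for random subsets. -/
theorem local_lemma (h0 : 0 ≤ q) (h1 : q ≤ 1) (hx0 : 0 ≤ x) (hx1 : x ≤ 1)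
    (hD : ∀ i ∈ I, D i ⊆ V) (hA : ∀ i ∈ I, ∀ S, S ∈ A i ↔ S ∩ D i ∈ A i)
    (hdeg : ∀ i ∈ I, ((touching D I (D i)).card : ℝ) * x ≤ 1 / 2)
    (hP : ∀ i ∈ I, subsetProb q V (A i) ≤ x / 2) {J : Finset ι} (hJ : J ⊆ I) :
    ∀ i ∈ I, subsetProb q V (A i ∩ avoid A J) ≤ x * subsetProb q V (avoid A J) := by
  induction J using Finset.strongInduction with
  | H J ih =>
    intro i hi
    set K := touching D J (D i) with hK
    have hKJ : K ⊆ J := Finset.filter_subset _ _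
    have hchain := avoid_chain (q := q) (V := V) (A := A) hx1 hKJ
      (fun J' hJ' j hj => ih J' hJ' (hJ'.subset.trans hJ) j (hJ hj))
    have hind := subsetProb_inter_avoid_untouched (q := q) (V := V) hA hJ (hD i hi) (hA i hi)
    have hmono : subsetProb q V (A i ∩ avoid A J) ≤ subsetProb q V (A i ∩ avoid A (J \ K)) :=
      subsetProb_mono h0 h1 fun S _ hS => ⟨hS.1, fun j hj => hS.2 j (Finset.sdiff_subset hj)⟩
    have hcard : (K.card : ℝ) ≤ (touching D I (D i)).card := by
      exact_mod_cast Finset.card_le_card (Finset.filter_subset_filter _ hJ)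
    have hb : 1 / 2 ≤ (1 - x) ^ K.card := by
      have h2 := one_add_mul_le_pow (show (-2 : ℝ) ≤ -x by linarith) K.card
      have h3 := hdeg i hi
      have h4 : (K.card : ℝ) * x ≤ (touching D I (D i)).card * x := by gcongr
      rw [← sub_eq_add_neg] at h2
      linarith
    have hn := subsetProb_nonneg h0 h1 V (avoid A (J \ K))
    calc _ ≤ _ := hmono
      _ = subsetProb q V (A i) * subsetProb q V (avoid A (J \ K)) := hind
      _ ≤ x / 2 * subsetProb q V (avoid A (J \ K)) := by gcongr; exact hP i hi
      _ = x * (1 / 2 * subsetProb q V (avoid A (J \ K))) := by ring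
      _ ≤ x * ((1 - x) ^ K.card * subsetProb q V (avoid A (J \ K))) := by gcongr
      _ ≤ _ := by gcongr

/-- Under the hypotheses of the local lemma, conditioning on avoiding all bad events increases the
probability of an event determined by the points of `C` by a controlled factor. -/
theorem local_lemma_conditional (h0 : 0 ≤ q) (h1 : q ≤ 1) (hx0 : 0 ≤ x) (hx1 : x ≤ 1)
    (hD : ∀ i ∈ I, D i ⊆ V) (hA : ∀ i ∈ I, ∀ S, S ∈ A i ↔ S ∩ D i ∈ A i)
    (hdeg : ∀ i ∈ I, ((touching D I (D i)).card : ℝ) * x ≤ 1 / 2)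
    (hP : ∀ i ∈ I, subsetProb q V (A i) ≤ x / 2)
    {C : Finset α} (hC : C ⊆ V) {E : Set (Finset α)} (hE : ∀ S, S ∈ E ↔ S ∩ C ∈ E) :
    (1 - x) ^ (touching D I C).card * subsetProb q V (E ∩ avoid A I)
      ≤ subsetProb q V E * subsetProb q V (avoid A I) := by
  set K := touching D I C with hK
  have hKJ : K ⊆ I := Finset.filter_subset _ _
  have hchain := avoid_chain (q := q) (V := V) (A := A) hx1 hKJ
    (fun J' hJ' j hj => local_lemma h0 h1 hx0 hx1 hD hA hdeg hP hJ'.subset j hj)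
  have hind := subsetProb_inter_avoid_untouched (q := q) (V := V) hA subset_rfl hC hE
  have hmono : subsetProb q V (E ∩ avoid A I) ≤ subsetProb q V (E ∩ avoid A (I \ K)) :=
    subsetProb_mono h0 h1 fun S _ hS => ⟨hS.1, fun j hj => hS.2 j (Finset.sdiff_subset hj)⟩
  have hx : 0 ≤ 1 - x := by linarith
  have hn := subsetProb_nonneg h0 h1 V E
  calc _ ≤ (1 - x) ^ K.card * subsetProb q V (E ∩ avoid A (I \ K)) := by gcongr
    _ = subsetProb q V E * ((1 - x) ^ K.card * subsetProb q V (avoid A (I \ K))) := by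
      rw [hind]; ring
    _ ≤ _ := by gcongr

lemma local_lemma_prob_avoid (h0 : 0 ≤ q) (h1 : q ≤ 1) (hx0 : 0 ≤ x) (hx1 : x ≤ 1)
    (hD : ∀ i ∈ I, D i ⊆ V) (hA : ∀ i ∈ I, ∀ S, S ∈ A i ↔ S ∩ D i ∈ A i)
    (hdeg : ∀ i ∈ I, ((touching D I (D i)).card : ℝ) * x ≤ 1 / 2)
    (hP : ∀ i ∈ I, subsetProb q V (A i) ≤ x / 2) :
    (1 - x) ^ I.card ≤ subsetProb q V (avoid A I) := by
  have hchain := avoid_chain (q := q) (V := V) (A := A) hx1 (subset_refl I)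
    (fun J' hJ' j hj => local_lemma h0 h1 hx0 hx1 hD hA hdeg hP hJ'.subset j hj)
  have : avoid A (∅ : Finset ι) = univ := by ext; simp [avoid]
  rwa [Finset.sdiff_self, this, subsetProb_univ, mul_one] at hchain

end LocalLemma

end BinomialSubset

section Grid

/-- The grid `[n]²` as a finset of points of `ℝ²`. -/
def gridFinset (n : ℕ) : Finset (ℝ × ℝ) :=
  (Finset.Icc (1 : ℤ) n ×ˢ Finset.Icc (1 : ℤ) n).image fun p => ((p.1 : ℝ), (p.2 : ℝ))

lemma coe_gridFinset (n : ℕ) : (gridFinset n : Set (ℝ × ℝ)) = grid2 n := by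
  ext p
  simp only [gridFinset, grid2, Finset.coe_image, mem_image, Finset.mem_coe, Finset.mem_product,
    Finset.mem_Icc, Prod.exists, mem_ofPred_eq]
  constructor
  · rintro ⟨a, b, ⟨⟨h1, h2⟩, h3, h4⟩, rfl⟩
    exact ⟨a, b, h1, h2, h3, h4, rfl⟩
  · rintro ⟨a, b, h1, h2, h3, h4, rfl⟩
    exact ⟨a, b, ⟨⟨h1, h2⟩, h3, h4⟩, rfl⟩

lemma exists_close_pair {n : ℕ} (A : Finset (ℤ × ℤ)) (hA : ∀ p ∈ A, 1 ≤ p.1 ∧ p.1 ≤ n)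
    (hk : 2 ≤ A.card) {u₁ u₂ : ℝ} (hu : u₁ ≠ 0) (hle : |u₂| ≤ |u₁|)
    (hdir : ∀ p ∈ A, ∀ q ∈ A, ((p.1 - q.1 : ℤ) : ℝ) * u₂ = ((p.2 - q.2 : ℤ) : ℝ) * u₁) :
    ∃ p ∈ A, ∃ q ∈ A, p ≠ q ∧ |p.1 - q.1| * (A.card : ℤ) ≤ 2 * n ∧
      |p.2 - q.2| * (A.card : ℤ) ≤ 2 * n := by
  obtain ⟨k, hk'⟩ : ∃ k, A.card = k + 1 := ⟨A.card - 1, by omega⟩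
  have hkpos : 0 < k := by omega
  set d := n / k with hd
  have hlt : n < (d + 1) * k := by
    rw [hd, add_mul, one_mul, mul_comm]
    exact Nat.lt_mul_div_succ n hkpos |>.trans_eq (by ring)
  obtain ⟨p, hp, q, hq, hpq, hf⟩ := Finset.exists_ne_map_eq_of_card_lt_of_maps_to
    (s := A) (t := Finset.range k) (by simp [hk']) (f := fun p => ((p.1 - 1) / ((d : ℤ) + 1)).toNat)
    (by
      intro p hp
      obtain ⟨h1, h2⟩ := hA p hp
      simp only [Finset.coe_range, mem_Iio]
      have h3 : (p.1 - 1) / ((d : ℤ) + 1) < k := by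
        apply Int.ediv_lt_of_lt_mul (by positivity)
        have : (n : ℤ) < (d + 1) * k := by exact_mod_cast hlt
        linarith
      omega)
  have hp1 := hA p hp
  have hq1 := hA q hq
  have hdpos : (0 : ℤ) < (d : ℤ) + 1 := by positivity
  have e : (p.1 - 1) / ((d : ℤ) + 1) = (q.1 - 1) / ((d : ℤ) + 1) := by
    have h1 : 0 ≤ (p.1 - 1) / ((d : ℤ) + 1) := Int.ediv_nonneg (by omega) hdpos.le
    have h2 : 0 ≤ (q.1 - 1) / ((d : ℤ) + 1) := Int.ediv_nonneg (by omega) hdpos.le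
    omega
  have hdiff : |p.1 - q.1| ≤ d := by
    have a1 := Int.mul_ediv_add_emod (p.1 - 1) ((d : ℤ) + 1)
    have a2 := Int.mul_ediv_add_emod (q.1 - 1) ((d : ℤ) + 1)
    have b1 := Int.emod_nonneg (p.1 - 1) hdpos.ne'
    have b2 := Int.emod_nonneg (q.1 - 1) hdpos.ne'
    have c1 := Int.emod_lt_of_pos (p.1 - 1) hdpos
    have c2 := Int.emod_lt_of_pos (q.1 - 1) hdpos
    rw [e] at a1
    rw [abs_le]
    constructor <;> linarith
  have hbound : ∀ t : ℤ, t ≤ d → t * (A.card : ℤ) ≤ 2 * n := by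
    intro t ht
    have h1 : (d : ℤ) * k ≤ n := by exact_mod_cast Nat.div_mul_le_self n k
    have h2 : (1 : ℤ) ≤ k := by exact_mod_cast hkpos
    have h3 : (0 : ℤ) ≤ d := by positivity
    rw [hk']
    push_cast
    nlinarith
  refine ⟨p, hp, q, hq, hpq, hbound _ hdiff, hbound _ (le_trans ?_ hdiff)⟩
  have h1 := congrArg abs (hdir p hp q hq)
  rw [abs_mul, abs_mul] at h1
  have h2 : |((p.2 - q.2 : ℤ) : ℝ)| ≤ |((p.1 - q.1 : ℤ) : ℝ)| := by
    have : 0 < |u₁| := abs_pos.2 hu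
    refine le_of_mul_le_mul_right ?_ this
    rw [← h1]
    gcongr
  exact_mod_cast h2

lemma InLines.exists_short_direction {n : ℕ} {L : AffineSubspace ℝ (ℝ × ℝ)} (hL : InLines n L) :
    ∃ v : ℤ × ℤ, L.direction = Submodule.span ℝ {((v.1 : ℝ), (v.2 : ℝ))} ∧
      |v.1| * ((grid2 n ∩ (L : Set (ℝ × ℝ))).ncard : ℤ) ≤ 2 * n ∧
      |v.2| * ((grid2 n ∩ (L : Set (ℝ × ℝ))).ncard : ℤ) ≤ 2 * n := by
  classical
  obtain ⟨hline, hk⟩ := hL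
  set c : ℤ × ℤ → ℝ × ℝ := fun p => ((p.1 : ℝ), (p.2 : ℝ)) with hc
  have hcinj : Function.Injective c := by
    rintro ⟨a, b⟩ ⟨a', b'⟩ h
    simpa [hc] using h
  set A : Finset (ℤ × ℤ) := (Finset.Icc (1 : ℤ) n ×ˢ Finset.Icc (1 : ℤ) n).filter
    fun p => c p ∈ L with hAdef
  have hAcard : (grid2 n ∩ (L : Set (ℝ × ℝ))).ncard = A.card := by
    rw [← Finset.card_image_of_injective A hcinj, ← Set.ncard_coe_finset]
    congr 1
    ext p
    rw [← coe_gridFinset]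
    simp only [gridFinset, hAdef, mem_inter_iff, Finset.coe_image, mem_image,
      Finset.mem_filter, SetLike.mem_coe]
    constructor
    · rintro ⟨⟨x, hx, rfl⟩, h2⟩
      exact ⟨x, ⟨hx, h2⟩, rfl⟩
    · rintro ⟨x, ⟨hx, h2⟩, rfl⟩
      exact ⟨⟨x, hx, rfl⟩, h2⟩
  rw [hAcard] at hk ⊢
  have hAL : ∀ p ∈ A, c p ∈ L := fun p hp => (Finset.mem_filter.1 hp).2
  have hAg : ∀ p ∈ A, (1 ≤ p.1 ∧ p.1 ≤ n) ∧ 1 ≤ p.2 ∧ p.2 ≤ n := fun p hp => by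
    have := (Finset.mem_filter.1 hp).1
    simpa using this
  obtain ⟨⟨u, hu⟩, hu0, hspan⟩ := finrank_eq_one_iff'.1 hline
  have hdir : ∀ p ∈ A, ∀ q ∈ A, ((p.1 - q.1 : ℤ) : ℝ) * u.2 = ((p.2 - q.2 : ℤ) : ℝ) * u.1 := by
    intro p hp q hq
    have hmem : c p -ᵥ c q ∈ L.direction := AffineSubspace.vsub_mem_direction (hAL p hp) (hAL q hq)
    obtain ⟨t, ht⟩ := hspan ⟨_, hmem⟩
    have ht' : t • u = c p - c q := congrArg Subtype.val ht
    have e1 : t * u.1 = (p.1 : ℝ) - q.1 := congrArg Prod.fst ht'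
    have e2 : t * u.2 = (p.2 : ℝ) - q.2 := congrArg Prod.snd ht'
    push_cast
    rw [← e1, ← e2]
    ring
  have hu0' : u ≠ 0 := fun h => hu0 (Subtype.ext h)
  have key : ∃ p ∈ A, ∃ q ∈ A, p ≠ q ∧ |p.1 - q.1| * (A.card : ℤ) ≤ 2 * n ∧
      |p.2 - q.2| * (A.card : ℤ) ≤ 2 * n := by
    rcases le_total |u.2| |u.1| with h | h
    · refine exists_close_pair A (fun p hp => (hAg p hp).1) hk ?_ h hdir
      intro h0
      rw [h0, abs_zero] at h
      exact hu0' (Prod.ext h0 (abs_nonpos_iff.1 h))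
    · have hs : (A.image Prod.swap).card = A.card :=
        Finset.card_image_of_injective A Prod.swap_injective
      obtain ⟨p, hp, q, hq, hne, h1, h2⟩ := exists_close_pair (A.image Prod.swap) (n := n)
        (u₁ := u.2) (u₂ := u.1) (by
          intro p hp
          obtain ⟨p', hp', rfl⟩ := Finset.mem_image.1 hp
          exact (hAg p' hp').2) (by rwa [hs]) (by
          intro h0
          rw [h0, abs_zero] at h
          exact hu0' (Prod.ext (abs_nonpos_iff.1 h) h0)) h (by
          intro p hp q hq
          obtain ⟨p', hp', rfl⟩ := Finset.mem_image.1 hp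
          obtain ⟨q', hq', rfl⟩ := Finset.mem_image.1 hq
          exact (hdir p' hp' q' hq').symm)
      obtain ⟨p', hp', rfl⟩ := Finset.mem_image.1 hp
      obtain ⟨q', hq', rfl⟩ := Finset.mem_image.1 hq
      rw [hs] at h1 h2
      exact ⟨p', hp', q', hq', fun h => hne (by rw [h]), h2, h1⟩
  obtain ⟨p, hp, q, hq, hne, h1, h2⟩ := key
  refine ⟨(p.1 - q.1, p.2 - q.2), ?_, h1, h2⟩
  have hmem : c p -ᵥ c q ∈ L.direction := AffineSubspace.vsub_mem_direction (hAL p hp) (hAL q hq)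
  have hv : ((((p.1 - q.1, p.2 - q.2) : ℤ × ℤ).1 : ℝ), (((p.1 - q.1, p.2 - q.2) : ℤ × ℤ).2 : ℝ))
      = c p -ᵥ c q := by
    simp [hc]
  rw [hv]
  have hv0 : (⟨c p -ᵥ c q, hmem⟩ : L.direction) ≠ 0 := by
    intro h
    have : c p -ᵥ c q = 0 := congrArg Subtype.val h
    exact hne (hcinj (vsub_eq_zero_iff_eq.1 this))
  apply le_antisymm
  · intro w hw
    obtain ⟨t, ht⟩ := (finrank_eq_one_iff_of_nonzero' _ hv0).1 hline ⟨w, hw⟩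
    exact Submodule.mem_span_singleton.2 ⟨t, congrArg Subtype.val ht⟩
  · rwa [Submodule.span_singleton_le_iff_mem]

/-- Few heavy lines pass through a given point. -/
lemma exists_finset_lines_through (n B : ℕ) (p : ℝ × ℝ) :
    ∃ F : Finset (AffineSubspace ℝ (ℝ × ℝ)), F.card ≤ (2 * B + 1) ^ 2 ∧
      ∀ L, InLines n L → p ∈ L →
        2 * n < (B + 1) * (grid2 n ∩ (L : Set (ℝ × ℝ))).ncard → L ∈ F := by
  classical
  refine ⟨(Finset.Icc (-(B : ℤ)) B ×ˢ Finset.Icc (-(B : ℤ)) B).image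
    fun v => AffineSubspace.mk' p (Submodule.span ℝ {((v.1 : ℝ), (v.2 : ℝ))}), ?_, ?_⟩
  · refine Finset.card_image_le.trans ?_
    rw [Finset.card_product, Int.card_Icc, ← sq]
    apply le_of_eq
    congr 1
    omega
  · intro L hL hp hk
    obtain ⟨v, hv, h1, h2⟩ := hL.exists_short_direction
    have hb : ∀ t : ℤ, |t| * ((grid2 n ∩ (L : Set (ℝ × ℝ))).ncard : ℤ) ≤ 2 * n →
        t ∈ Finset.Icc (-(B : ℤ)) B := by
      intro t ht
      have hk' : (2 * n : ℤ) < (B + 1) * ((grid2 n ∩ (L : Set (ℝ × ℝ))).ncard : ℤ) := by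
        exact_mod_cast hk
      have := lt_of_mul_lt_mul_right (ht.trans_lt hk') (by positivity)
      rw [Finset.mem_Icc, ← abs_le]
      omega
    refine Finset.mem_image.2 ⟨v, Finset.mem_product.2 ⟨hb _ h1, hb _ h2⟩, ?_⟩
    rw [← hv]
    exact AffineSubspace.mk'_eq hp

end Grid

section Numerics

lemma pow_le_exp_sq {z : ℝ} (hz : 1000 ≤ z) : z ^ 250 ≤ Real.exp (z ^ 2 / 32) := by
  have h1 : z ^ 2 / 16000 ≤ Real.exp (z ^ 2 / 16000) := by
    linarith [Real.add_one_le_exp (z ^ 2 / 16000)]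
  have h2 : z ≤ (z ^ 2 / 16000) ^ 2 := by
    have h3 : (1000 : ℝ) ^ 3 ≤ z ^ 3 := by gcongr
    have h4 : (z ^ 2 / 16000) ^ 2 = z * (z ^ 3 / 256000000) := by ring
    rw [h4]
    refine le_mul_of_one_le_right (by linarith) ?_
    rw [le_div_iff₀ (by norm_num)]
    linarith
  calc z ^ 250 ≤ ((z ^ 2 / 16000) ^ 2) ^ 250 := by gcongr
    _ = (z ^ 2 / 16000) ^ 500 := by rw [← pow_mul]
    _ ≤ Real.exp (z ^ 2 / 16000) ^ 500 := by gcongr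
    _ = Real.exp (z ^ 2 / 32) := by rw [← Real.exp_nat_mul]; congr 1; push_cast; ring

lemma exp_neg_sq_le {z : ℝ} (hz : 1000 ≤ z) :
    2 * Real.exp (-(z ^ 2 / 32)) ≤ 1 / 10 ^ 6 * (z ^ 180)⁻¹ / 2 := by
  have h1 := pow_le_exp_sq hz
  have hz0 : 0 < z := by linarith
  have h2 : (1000 : ℝ) ^ 70 ≤ z ^ 70 := by gcongr
  have h3 : z ^ 250 = z ^ 180 * z ^ 70 := by ring
  have h4 : (z ^ 180) * (4 * 10 ^ 6) ≤ Real.exp (z ^ 2 / 32) := by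
    refine le_trans ?_ h1
    rw [h3]
    gcongr
    refine le_trans ?_ h2
    norm_num
  have h5 : Real.exp (-(z ^ 2 / 32)) ≤ (z ^ 180 * (4 * 10 ^ 6))⁻¹ := by
    rw [Real.exp_neg]
    gcongr
  refine (mul_le_mul_of_nonneg_left h5 (by norm_num)).trans (le_of_eq ?_)
  rw [mul_inv]
  ring

lemma exp_neg_two_mul_le {x : ℝ} (h0 : 0 ≤ x) (h1 : x ≤ 1 / 4) : Real.exp (-(2 * x)) ≤ 1 - x := by
  have h2 := (abs_le.1 (Real.abs_exp_sub_one_sub_id_le (x := -x)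
    (by rw [abs_neg, abs_of_nonneg h0]; linarith))).2
  have h3 : Real.exp (-(2 * x)) = Real.exp (-x) ^ 2 := by
    rw [← Real.exp_nat_mul]; congr 1; push_cast; ring
  have h4 := Real.exp_pos (-x)
  have h5 : Real.exp (-x) ≤ 1 - x + x ^ 2 := by nlinarith
  rw [h3]
  have h6 : (1 - x + x ^ 2) ^ 2 ≤ 1 - x := by
    have h7 : 3 * x + x ^ 3 ≤ 1 := by
      have : x ^ 3 ≤ (1 / 4) ^ 3 := by gcongr
      linarith
    have h8 : (1 - x + x ^ 2) ^ 2 = 1 - x - x * (1 - (3 * x + x ^ 3) + 2 * x ^ 2) := by ring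
    have h9 : 0 ≤ x * (1 - (3 * x + x ^ 3) + 2 * x ^ 2) :=
      mul_nonneg h0 (add_nonneg (sub_nonneg.2 h7) (by positivity))
    linarith
  exact (pow_le_pow_left₀ h4.le h5 2).trans h6

lemma exp_neg_le_one_sub_pow {x y : ℝ} (h0 : 0 ≤ x) (h1 : x ≤ 1 / 4) {c : ℕ} (hc : x * c ≤ y) :
    Real.exp (-(2 * y)) ≤ (1 - x) ^ c := by
  calc Real.exp (-(2 * y)) ≤ Real.exp (c * (-(2 * x))) := by
        apply Real.exp_le_exp.2; linarith
    _ = Real.exp (-(2 * x)) ^ c := Real.exp_nat_mul _ _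
    _ ≤ (1 - x) ^ c := by
      gcongr
      exact exp_neg_two_mul_le h0 h1

lemma four_pow_mul_exp_le {z : ℝ} (hz : 1000 ≤ z) {n : ℕ} (hn : z ^ 12 ≤ n) :
    (4 : ℝ) ^ n * (2 * Real.exp (-(n * z ^ 10 / 3200))) ≤ 1 / (8 * z ^ 12) * Real.exp (-n) := by
  have hz0 : 0 < z := by linarith
  have h12 : (1000 : ℝ) ^ 12 ≤ z ^ 12 := by gcongr
  have h10 : (1000 : ℝ) ^ 10 ≤ z ^ 10 := by gcongr
  have hn16 : (16 : ℝ) ≤ n := by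
    refine le_trans ?_ hn
    refine le_trans ?_ h12
    norm_num
  have hexp4 : (4 : ℝ) ≤ Real.exp 2 := by
    have h := Real.add_one_le_exp (1 : ℝ)
    have : Real.exp 2 = Real.exp 1 ^ 2 := by rw [← Real.exp_nat_mul]; norm_num
    rw [this]
    nlinarith
  have h4 : (4 : ℝ) ^ n ≤ Real.exp (2 * n) := by
    rw [mul_comm, Real.exp_nat_mul]
    gcongr
  have h5 : Real.exp (-(n * z ^ 10 / 3200)) ≤ Real.exp (-(5 * n)) := by
    apply Real.exp_le_exp.2
    have : (n : ℝ) * 16000 ≤ n * z ^ 10 := by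
      gcongr
      refine le_trans ?_ h10
      norm_num
    linarith
  have h6 : 16 * z ^ 12 ≤ Real.exp (2 * n) := by
    have h := Real.add_one_le_exp (n : ℝ)
    have : Real.exp (2 * n) = Real.exp n ^ 2 := by rw [← Real.exp_nat_mul]; norm_num
    rw [this]
    nlinarith
  have h7 : 2 * Real.exp (-(2 * n)) ≤ 1 / (8 * z ^ 12) := by
    rw [Real.exp_neg, le_div_iff₀ (by positivity)]
    have hp := Real.exp_pos (2 * n : ℝ)
    field_simp
    linarith
  calc _ ≤ Real.exp (2 * n) * (2 * Real.exp (-(5 * n))) := by gcongr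
    _ = 2 * Real.exp (-(2 * n)) * Real.exp (-n) := by
      rw [mul_left_comm, ← Real.exp_add, mul_assoc, ← Real.exp_add]
      congr 2
      ring
    _ ≤ _ := by gcongr

end Numerics

section Nice

/-- The notion of being `z ^ 12`-nice, with all fractional powers written as integer powers
of `z`. -/
def NiceAt (n : ℕ) (z : ℝ) (S : Set (ℝ × ℝ)) : Prop :=
  S ⊆ grid2 n ∧
  (∀ L : AffineSubspace ℝ (ℝ × ℝ), InLines n L →
    (z ^ 8)⁻¹ < lineWeight n L → lineWeight n L ≤ 1 →
    (1 - z⁻¹) * z ^ 12 * lineWeight n L ≤ ((S ∩ (L : Set (ℝ × ℝ))).ncard : ℝ) ∧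
    ((S ∩ (L : Set (ℝ × ℝ))).ncard : ℝ) ≤ (1 + z⁻¹) * z ^ 12 * lineWeight n L) ∧
  (∀ L : AffineSubspace ℝ (ℝ × ℝ), InLines n L →
    (z ^ 24)⁻¹ < lineWeight n L → lineWeight n L ≤ (z ^ 8)⁻¹ →
    ((S ∩ (L : Set (ℝ × ℝ))).ncard : ℝ) ≤ (1 + z⁻¹) * z ^ 4) ∧
  (∀ L : AffineSubspace ℝ (ℝ × ℝ), InLines n L →
    lineWeight n L ≤ (z ^ 24)⁻¹ → (S ∩ (L : Set (ℝ × ℝ))).ncard ≤ 14) ∧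
  (∀ I J : Finset ℤ, ↑I ⊆ Set.Icc (1 : ℤ) (n : ℤ) → ↑J ⊆ Set.Icc (1 : ℤ) (n : ℤ) →
    (n : ℝ) / 10 ≤ I.card → (n : ℝ) / 10 ≤ J.card →
    (1 - z⁻¹) * I.card * J.card * z ^ 12 / n ≤ ((S ∩ gridRect I J).ncard : ℝ) ∧
    ((S ∩ gridRect I J).ncard : ℝ) ≤ (1 + z⁻¹) * I.card * J.card * z ^ 12 / n)

lemma isNice_pow_twelve_iff {n : ℕ} {z : ℝ} (hz : 0 < z) (S : Set (ℝ × ℝ)) :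
    IsNice n (z ^ 12) S ↔ NiceAt n z S := by
  have hz' := hz.le
  have e (a : ℝ) : (z ^ 12) ^ a = z ^ (12 * a) := by
    rw [← Real.rpow_natCast, ← Real.rpow_mul hz']; norm_num
  have e1 : (z ^ 12) ^ (-(2 : ℝ) / 3) = (z ^ 8)⁻¹ := by
    rw [e, ← Real.rpow_natCast, ← Real.rpow_neg hz']; norm_num
  have e2 : (z ^ 12) ^ (-(1 : ℝ) / 12) = z⁻¹ := by
    rw [e, ← Real.rpow_neg_one]; norm_num
  have e3 : (z ^ 12) ^ (-(2 : ℝ)) = (z ^ 24)⁻¹ := by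
    rw [e, ← Real.rpow_natCast, ← Real.rpow_neg hz']; norm_num
  have e4 : (z ^ 12) ^ ((1 : ℝ) / 3) = z ^ 4 := by
    rw [e, ← Real.rpow_natCast]; norm_num
  rw [IsNice, NiceAt, e1, e2, e3, e4]

/-- A set of density about `M / n` in the grid, regular enough that a random subset of density
`z ^ 12 / n` is likely to be `z ^ 12`-nice. -/
structure IsUniformBase (n : ℕ) (z M : ℝ) (V : Set (ℝ × ℝ)) : Prop where
  subset : V ⊆ grid2 n
  le_density : z ^ 12 ≤ M
  density_le : M ≤ z ^ 36
  heavy : ∀ L : AffineSubspace ℝ (ℝ × ℝ), InLines n L →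
    (z ^ 24)⁻¹ < lineWeight n L → lineWeight n L ≤ 1 →
    (1 - (z ^ 3)⁻¹) * M * lineWeight n L ≤ ((V ∩ (L : Set (ℝ × ℝ))).ncard : ℝ) ∧
    ((V ∩ (L : Set (ℝ × ℝ))).ncard : ℝ) ≤ (1 + (z ^ 3)⁻¹) * M * lineWeight n L
  medium : ∀ L : AffineSubspace ℝ (ℝ × ℝ), InLines n L →
    (z ^ 72)⁻¹ < lineWeight n L → lineWeight n L ≤ (z ^ 24)⁻¹ →
    z ^ 24 * ((V ∩ (L : Set (ℝ × ℝ))).ncard : ℝ) ≤ 2 * M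
  light : ∀ L : AffineSubspace ℝ (ℝ × ℝ), InLines n L →
    lineWeight n L ≤ (z ^ 72)⁻¹ → (V ∩ (L : Set (ℝ × ℝ))).ncard ≤ 14
  rect : ∀ I J : Finset ℤ, ↑I ⊆ Set.Icc (1 : ℤ) (n : ℤ) → ↑J ⊆ Set.Icc (1 : ℤ) (n : ℤ) →
    (n : ℝ) / 10 ≤ I.card → (n : ℝ) / 10 ≤ J.card →
    (1 - (z ^ 3)⁻¹) * I.card * J.card * M / n ≤ ((V ∩ gridRect I J).ncard : ℝ) ∧
    ((V ∩ gridRect I J).ncard : ℝ) ≤ (1 + (z ^ 3)⁻¹) * I.card * J.card * M / n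

lemma NiceAt.isUniformBase {n : ℕ} {z : ℝ} (hz : 1 ≤ z) {V : Set (ℝ × ℝ)}
    (h : NiceAt n (z ^ 3) V) : IsUniformBase n z (z ^ 36) V := by
  obtain ⟨h0, h1, h2, h3, h4⟩ := h
  simp only [← pow_mul, Nat.reduceMul] at h1 h2 h3 h4
  refine ⟨h0, pow_le_pow_right₀ hz (by norm_num), le_rfl, h1, ?_, h3, h4⟩
  intro L hL hw hw'
  have h5 := h2 L hL hw hw'
  have h6 : (z ^ 3)⁻¹ ≤ 1 := inv_le_one_of_one_le₀ (one_le_pow₀ hz)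
  calc _ ≤ z ^ 24 * ((1 + (z ^ 3)⁻¹) * z ^ 12) := by gcongr
    _ ≤ z ^ 24 * ((1 + 1) * z ^ 12) := by gcongr
    _ = _ := by ring

lemma ncard_gridRect (I J : Finset ℤ) : (gridRect I J).ncard = I.card * J.card := by
  have : gridRect I J
      = ((I ×ˢ J).image fun p : ℤ × ℤ => ((p.1 : ℝ), (p.2 : ℝ)) : Finset (ℝ × ℝ)) := by
    ext p
    simp only [gridRect, mem_ofPred_eq, Finset.coe_image, mem_image, Finset.mem_coe,
      Finset.mem_product, Prod.exists]
    constructor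
    · rintro ⟨a, ha, b, hb, rfl⟩
      exact ⟨a, b, ⟨ha, hb⟩, rfl⟩
    · rintro ⟨a, b, ⟨ha, hb⟩, rfl⟩
      exact ⟨a, ha, b, hb, rfl⟩
  rw [this, Set.ncard_coe_finset, Finset.card_image_of_injective, Finset.card_product]
  rintro ⟨a, b⟩ ⟨a', b'⟩ h
  simpa using h

lemma gridRect_subset {n : ℕ} {I J : Finset ℤ} (hI : ↑I ⊆ Set.Icc (1 : ℤ) (n : ℤ))
    (hJ : ↑J ⊆ Set.Icc (1 : ℤ) (n : ℤ)) : gridRect I J ⊆ grid2 n := by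
  rintro p ⟨a, ha, b, hb, rfl⟩
  exact ⟨a, b, (hI ha).1, (hI ha).2, (hJ hb).1, (hJ hb).2, rfl⟩

lemma grid2_subset_gridRect (n : ℕ) :
    grid2 n ⊆ gridRect (Finset.Icc 1 (n : ℤ)) (Finset.Icc 1 (n : ℤ)) := by
  rintro p ⟨a, b, h1, h2, h3, h4, rfl⟩
  exact ⟨a, Finset.mem_Icc.2 ⟨h1, h2⟩, b, Finset.mem_Icc.2 ⟨h3, h4⟩, rfl⟩

lemma isUniformBase_grid {n : ℕ} (hn : 0 < n) {z : ℝ} (hz : 1 ≤ z) (h1 : z ^ 12 ≤ n)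
    (h2 : n ≤ z ^ 36) : IsUniformBase n z n (grid2 n) := by
  have hn' : (0 : ℝ) < n := by exact_mod_cast hn
  have hz0 : 0 < z := by linarith
  have hcount (L : AffineSubspace ℝ (ℝ × ℝ)) :
      ((grid2 n ∩ (L : Set (ℝ × ℝ))).ncard : ℝ) = n * lineWeight n L := by
    rw [lineWeight]; field_simp
  have hi : 0 ≤ (z ^ 3)⁻¹ := by positivity
  refine ⟨subset_rfl, h1, h2, ?_, ?_, ?_, ?_⟩
  · intro L hL hw hw'
    have hw0 : 0 ≤ n * lineWeight n L := by rw [← hcount]; positivity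
    rw [hcount]
    constructor <;> nlinarith
  · intro L hL hw hw'
    rw [hcount]
    calc z ^ 24 * ((n : ℝ) * lineWeight n L) ≤ z ^ 24 * ((n : ℝ) * (z ^ 24)⁻¹) := by gcongr
      _ = (n : ℝ) := by field_simp
      _ ≤ _ := by linarith
  · intro L hL hw
    exfalso
    have h3 : (2 : ℝ) ≤ (grid2 n ∩ (L : Set (ℝ × ℝ))).ncard := by exact_mod_cast hL.2
    rw [hcount] at h3
    have h0 : 0 ≤ lineWeight n L := by rw [lineWeight]; positivity
    have h4 : (n : ℝ) * lineWeight n L ≤ z ^ 36 * (z ^ 72)⁻¹ := by gcongr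
    have h5 : z ^ 36 * (z ^ 72)⁻¹ = (z ^ 36)⁻¹ := by field_simp
    have h6 : (z ^ 36)⁻¹ ≤ 1 := inv_le_one_of_one_le₀ (one_le_pow₀ hz)
    linarith
  · intro I J hI hJ _ _
    rw [inter_eq_self_of_subset_right (gridRect_subset hI hJ), ncard_gridRect]
    push_cast
    have h3 : 0 ≤ (I.card : ℝ) * J.card := by positivity
    constructor
    · rw [mul_div_cancel_right₀ _ hn'.ne']; nlinarith
    · rw [mul_div_cancel_right₀ _ hn'.ne']; nlinarith

end Nice

section Subsample

lemma ncard_coe_inter {V S : Finset (ℝ × ℝ)} (hS : S ⊆ V) (P : Set (ℝ × ℝ))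
    [DecidablePred (· ∈ P)] :
    ((S : Set (ℝ × ℝ)) ∩ P).ncard = (S ∩ V.filter (· ∈ P)).card := by
  rw [← Set.ncard_coe_finset]
  congr 1
  ext p
  simp only [mem_inter_iff, Finset.mem_coe, Finset.coe_inter, Finset.coe_filter, mem_ofPred_eq]
  exact ⟨fun h => ⟨h.1, hS h.1, h.2⟩, fun h => ⟨h.1, h.2.2⟩⟩

section Deviation

variable {α : Type*} [DecidableEq α] {z M W : ℝ} {D V : Finset α}

lemma subsetProb_upper_deviation (hz : 1000 ≤ z) (hM : z ^ 12 ≤ M) (hD : D ⊆ V) (hW : 0 ≤ W)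
    (hcard : (D.card : ℝ) ≤ (1 + (z ^ 3)⁻¹) * M * W) :
    subsetProb (z ^ 12 / M) V {S | (1 + z⁻¹) * z ^ 12 * W < (S ∩ D).card}
      ≤ Real.exp (-(z ^ 10 * W / 32)) := by
  have hz0 : 0 < z := by linarith
  have hM0 : 0 < M := lt_of_lt_of_le (by positivity) hM
  have hi : z⁻¹ ≤ 1 / 1000 := by rw [inv_le_comm₀ hz0 (by norm_num)]; linarith
  have hi0 : 0 < z⁻¹ := by positivity
  have h3 : (z ^ 3)⁻¹ = z⁻¹ ^ 3 := by rw [inv_pow]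
  rw [h3] at hcard
  have hcube : z⁻¹ ^ 3 ≤ z⁻¹ * (1 / 1000) ^ 2 := by
    rw [pow_succ' z⁻¹ 2]
    gcongr
  refine (subsetProb_upper_tail (by positivity) ((div_le_one hM0).2 hM) hD
    (U := (1 + z⁻¹ ^ 3) * (z ^ 12 * W)) (t := z⁻¹ / 2) ?_ (by positivity) (by linarith) _
    ?_).trans ?_
  · calc z ^ 12 / M * D.card ≤ z ^ 12 / M * ((1 + z⁻¹ ^ 3) * M * W) := by gcongr
      _ = _ := by field_simp
  · intro S hS
    refine le_trans ?_ (le_of_lt hS)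
    rw [← mul_assoc, mul_assoc (1 + z⁻¹) (z ^ 12)]
    gcongr
    nlinarith
  · apply Real.exp_le_exp.2
    have : z ^ 10 * W / 32 ≤ 1 * (z ^ 12 * W) * (z⁻¹ / 2) ^ 2 / 4 := by
      have : 1 * (z ^ 12 * W) * (z⁻¹ / 2) ^ 2 / 4 = z ^ 10 * W / 16 := by field_simp; ring
      rw [this]
      gcongr
      norm_num
    have h4 : 1 * (z ^ 12 * W) * (z⁻¹ / 2) ^ 2 / 4
        ≤ (1 + z⁻¹ ^ 3) * (z ^ 12 * W) * (z⁻¹ / 2) ^ 2 / 4 := by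
      gcongr
      linarith [pow_pos hi0 3]
    linarith

lemma subsetProb_lower_deviation (hz : 1000 ≤ z) (hM : z ^ 12 ≤ M) (hD : D ⊆ V) (hW : 0 ≤ W)
    (hcard : (1 - (z ^ 3)⁻¹) * M * W ≤ (D.card : ℝ)) :
    subsetProb (z ^ 12 / M) V {S | ((S ∩ D).card : ℝ) < (1 - z⁻¹) * z ^ 12 * W}
      ≤ Real.exp (-(z ^ 10 * W / 32)) := by
  have hz0 : 0 < z := by linarith
  have hM0 : 0 < M := lt_of_lt_of_le (by positivity) hM
  have hi : z⁻¹ ≤ 1 / 1000 := by rw [inv_le_comm₀ hz0 (by norm_num)]; linarith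
  have hi0 : 0 < z⁻¹ := by positivity
  have h3 : (z ^ 3)⁻¹ = z⁻¹ ^ 3 := by rw [inv_pow]
  rw [h3] at hcard
  have hcube : z⁻¹ ^ 3 ≤ z⁻¹ * (1 / 1000) ^ 2 := by
    rw [pow_succ' z⁻¹ 2]
    gcongr
  refine (subsetProb_lower_tail (by positivity) ((div_le_one hM0).2 hM) hD
    (U := (1 - z⁻¹ ^ 3) * (z ^ 12 * W)) (t := z⁻¹ / 2) ?_ (by positivity) (by linarith) _
    ?_).trans ?_
  · calc (1 - z⁻¹ ^ 3) * (z ^ 12 * W) = z ^ 12 / M * ((1 - z⁻¹ ^ 3) * M * W) := by field_simp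
      _ ≤ _ := by gcongr
  · intro S hS
    refine le_trans (le_of_lt hS) ?_
    rw [← mul_assoc, mul_assoc (1 - z⁻¹) (z ^ 12)]
    gcongr
    nlinarith
  · apply Real.exp_le_exp.2
    have : z ^ 10 * W / 32 = 1 / 2 * (z ^ 12 * W) * (z⁻¹ / 2) ^ 2 / 4 := by field_simp; ring
    have h4 : 1 / 2 * (z ^ 12 * W) * (z⁻¹ / 2) ^ 2 / 4
        ≤ (1 - z⁻¹ ^ 3) * (z ^ 12 * W) * (z⁻¹ / 2) ^ 2 / 4 := by
      gcongr
      linarith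
    linarith

end Deviation

/-- A number `N` of points that a nice set may not have on a line of weight `w`. -/
def BadCount (z w : ℝ) (N : ℕ) : Prop :=
  (w ≤ (z ^ 24)⁻¹ ∧ 15 ≤ N) ∨
  ((z ^ 24)⁻¹ < w ∧ w ≤ (z ^ 8)⁻¹ ∧ (1 + z⁻¹) * z ^ 4 < N) ∨
  ((z ^ 8)⁻¹ < w ∧ ((N : ℝ) < (1 - z⁻¹) * z ^ 12 * w ∨ (1 + z⁻¹) * z ^ 12 * w < N))

open Classical in
/-- The points of `V` on the line `L`. -/
def lineTrace (V : Finset (ℝ × ℝ)) (L : AffineSubspace ℝ (ℝ × ℝ)) : Finset (ℝ × ℝ) :=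
  V.filter (· ∈ (L : Set (ℝ × ℝ)))

lemma card_lineTrace (V : Finset (ℝ × ℝ)) (L : AffineSubspace ℝ (ℝ × ℝ)) :
    (lineTrace V L).card = ((V : Set (ℝ × ℝ)) ∩ L).ncard := by
  classical
  rw [ncard_coe_inter subset_rfl, lineTrace, Finset.inter_eq_right.2 (Finset.filter_subset _ _)]

variable {n : ℕ} {z M : ℝ} {V : Finset (ℝ × ℝ)}

lemma IsUniformBase.card_lineTrace_le (hz : 1000 ≤ z) (hV : IsUniformBase n z M V)
    {L : AffineSubspace ℝ (ℝ × ℝ)} (hL : InLines n L) (hw : (z ^ 72)⁻¹ < lineWeight n L)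
    (hw1 : lineWeight n L ≤ 1) : ((lineTrace V L).card : ℝ) ≤ 2 * z ^ 36 := by
  have hz0 : 0 < z := by linarith
  have hM0 : 0 < M := lt_of_lt_of_le (by positivity) hV.le_density
  have hz1 : 1 ≤ z := by linarith
  refine le_trans ?_ (mul_le_mul_of_nonneg_left hV.density_le zero_le_two)
  rw [card_lineTrace]
  rcases le_or_gt (lineWeight n L) (z ^ 24)⁻¹ with h | h
  · refine le_trans ?_ (hV.medium L hL hw h)
    exact le_mul_of_one_le_left (by positivity) (one_le_pow₀ hz1)
  · refine (hV.heavy L hL h hw1).2.trans ?_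
    have hi : (z ^ 3)⁻¹ ≤ 1 := inv_le_one_of_one_le₀ (one_le_pow₀ hz1)
    have h0 : 0 ≤ lineWeight n L := by rw [lineWeight]; positivity
    calc _ ≤ (1 + 1) * M * 1 := by gcongr
      _ = _ := by ring

lemma IsUniformBase.prob_badCount_le (hz : 1000 ≤ z) (hV : IsUniformBase n z M V)
    {L : AffineSubspace ℝ (ℝ × ℝ)} (hL : InLines n L) (hw : (z ^ 72)⁻¹ < lineWeight n L)
    (hw1 : lineWeight n L ≤ 1) :
    subsetProb (z ^ 12 / M) V {S | BadCount z (lineWeight n L) (S ∩ lineTrace V L).card}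
      ≤ 1 / 10 ^ 6 * (z ^ 180)⁻¹ / 2 := by
  have hz0 : 0 < z := by linarith
  have hM0 : 0 < M := lt_of_lt_of_le (by positivity) hV.le_density
  have hz1 : 1 ≤ z := by linarith
  have hq0 : 0 ≤ z ^ 12 / M := by positivity
  have hq1 : z ^ 12 / M ≤ 1 := (div_le_one hM0).2 hV.le_density
  have hsub : lineTrace V L ⊆ V := by classical exact Finset.filter_subset _ _
  have h824 : (z ^ 24)⁻¹ ≤ (z ^ 8)⁻¹ :=
    inv_anti₀ (by positivity) (pow_le_pow_right₀ hz1 (by norm_num))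
  have hw0 : 0 ≤ lineWeight n L := by rw [lineWeight]; positivity
  have hexp {W : ℝ} (hW : (z ^ 8)⁻¹ ≤ W) :
      Real.exp (-(z ^ 10 * W / 32)) ≤ Real.exp (-(z ^ 2 / 32)) := by
    apply Real.exp_le_exp.2
    have : z ^ 10 * (z ^ 8)⁻¹ ≤ z ^ 10 * W := by gcongr
    have h2 : z ^ 10 * (z ^ 8)⁻¹ = z ^ 2 := by field_simp
    linarith
  rcases le_or_gt (lineWeight n L) (z ^ 24)⁻¹ with h | h
  · have h15 := subsetProb_card_ge_le hq0 hq1 hsub 15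
    refine (subsetProb_mono hq0 hq1 fun S _ hS => ?_).trans (h15.trans ?_)
    · rcases hS with hS | hS | hS
      · exact hS.2
      · exact absurd h (not_le.2 hS.1)
      · exact absurd (h.trans h824) (not_le.2 hS.1)
    · have hm := hV.medium L hL hw h
      rw [← card_lineTrace] at hm
      have h1 : z ^ 12 / M * (lineTrace V L).card ≤ 2 * (z ^ 12)⁻¹ := by
        rw [div_mul_eq_mul_div, div_le_iff₀ hM0]
        have h2 : z ^ 12 * ((lineTrace V L).card : ℝ)
            = (z ^ 12)⁻¹ * (z ^ 24 * (lineTrace V L).card) := by field_simp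
        rw [h2]
        calc _ ≤ (z ^ 12)⁻¹ * (2 * M) := by gcongr
          _ = _ := by ring
      calc _ ≤ (2 * (z ^ 12)⁻¹) ^ 15 / (Nat.factorial 15 : ℕ) := by gcongr
        _ = 2 ^ 15 / (Nat.factorial 15 : ℕ) * (z ^ 180)⁻¹ := by
          rw [mul_pow, inv_pow, ← pow_mul]; ring
        _ ≤ 1 / 10 ^ 6 / 2 * (z ^ 180)⁻¹ := by
          refine mul_le_mul_of_nonneg_right ?_ (by positivity)
          norm_num [Nat.factorial]
        _ = _ := by ring
  · have hheavy := hV.heavy L hL h hw1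
    rw [← card_lineTrace] at hheavy
    refine le_trans ?_ (exp_neg_sq_le hz)
    rcases le_or_gt (lineWeight n L) (z ^ 8)⁻¹ with h8 | h8
    · have hup := subsetProb_upper_deviation hz hV.le_density hsub (W := (z ^ 8)⁻¹)
        (by positivity) (hheavy.2.trans (by gcongr))
      have hpos := Real.exp_pos (-(z ^ 2 / 32))
      refine (subsetProb_mono hq0 hq1 fun S _ hS => ?_).trans
        ((hup.trans (hexp le_rfl)).trans (by linarith))
      have e : (1 + z⁻¹) * z ^ 12 * (z ^ 8)⁻¹ = (1 + z⁻¹) * z ^ 4 := by field_simp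
      rcases hS with hS | hS | hS
      · exact absurd hS.1 (not_le.2 h)
      · rw [mem_ofPred_eq, e]
        exact hS.2.2
      · exact absurd h8 (not_le.2 hS.1)
    · have hup := subsetProb_upper_deviation hz hV.le_density hsub hw0 hheavy.2
      have hlow := subsetProb_lower_deviation hz hV.le_density hsub hw0 hheavy.1
      have hun := subsetProb_union_le hq0 hq1 V
        {S | ((S ∩ lineTrace V L).card : ℝ) < (1 - z⁻¹) * z ^ 12 * lineWeight n L}
        {S | (1 + z⁻¹) * z ^ 12 * lineWeight n L < (S ∩ lineTrace V L).card}
      have he := hexp h8.le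
      refine (subsetProb_mono hq0 hq1 fun S _ hS => ?_).trans
        (hun.trans (by linarith))
      rcases hS with hS | hS | hS
      · exact absurd hS.1 (not_le.2 h)
      · exact absurd hS.2.1 (not_le.2 h8)
      · exact hS.2

/-- The event that some large rectangle has an unusual number of points. -/
def badRects (n : ℕ) (z : ℝ) : Set (Finset (ℝ × ℝ)) :=
  {S | ∃ I J : Finset ℤ, ↑I ⊆ Set.Icc (1 : ℤ) (n : ℤ) ∧ ↑J ⊆ Set.Icc (1 : ℤ) (n : ℤ) ∧
    (n : ℝ) / 10 ≤ I.card ∧ (n : ℝ) / 10 ≤ J.card ∧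
    (((S : Set (ℝ × ℝ)) ∩ gridRect I J).ncard < (1 - z⁻¹) * I.card * J.card * z ^ 12 / n ∨
    (1 + z⁻¹) * I.card * J.card * z ^ 12 / n < ((S : Set (ℝ × ℝ)) ∩ gridRect I J).ncard)}

lemma IsUniformBase.prob_badRects_le (hn : 0 < n) (hz : 1000 ≤ z) (hzn : z ^ 12 ≤ n)
    (hV : IsUniformBase n z M V) :
    subsetProb (z ^ 12 / M) V (badRects n z) ≤ 1 / (8 * z ^ 12) * Real.exp (-n) := by
  classical
  have hz0 : 0 < z := by linarith
  have hn0 : (0 : ℝ) < n := by exact_mod_cast hn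
  have hM0 : 0 < M := lt_of_lt_of_le (by positivity) hV.le_density
  have hq0 : 0 ≤ z ^ 12 / M := by positivity
  have hq1 : z ^ 12 / M ≤ 1 := (div_le_one hM0).2 hV.le_density
  set P := ((Finset.Icc (1 : ℤ) n).powerset ×ˢ (Finset.Icc (1 : ℤ) n).powerset).filter
    fun IJ => (n : ℝ) / 10 ≤ IJ.1.card ∧ (n : ℝ) / 10 ≤ IJ.2.card with hP
  set D : Finset ℤ × Finset ℤ → Finset (ℝ × ℝ) := fun IJ =>
    V.filter (· ∈ gridRect IJ.1 IJ.2) with hD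
  set W : Finset ℤ × Finset ℤ → ℝ := fun IJ => IJ.1.card * IJ.2.card / n with hW
  have hcover : subsetProb (z ^ 12 / M) V (badRects n z) ≤ subsetProb (z ^ 12 / M) V
      (⋃ IJ ∈ P, {S | ((S ∩ D IJ).card : ℝ) < (1 - z⁻¹) * z ^ 12 * W IJ} ∪
        {S | (1 + z⁻¹) * z ^ 12 * W IJ < (S ∩ D IJ).card}) := by
    refine subsetProb_mono hq0 hq1 fun S hS hbad => ?_
    obtain ⟨I, J, hI, hJ, hI', hJ', h⟩ := hbad
    simp only [mem_iUnion]
    refine ⟨(I, J), ?_, ?_⟩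
    · simp only [hP, Finset.mem_filter, Finset.mem_product, Finset.mem_powerset]
      refine ⟨⟨?_, ?_⟩, hI', hJ'⟩ <;> rw [← Finset.coe_subset, Finset.coe_Icc] <;> assumption
    · rw [ncard_coe_inter hS] at h
      have e (c : ℝ) : c * I.card * J.card * z ^ 12 / n = c * z ^ 12 * W (I, J) := by
        simp only [hW]; ring
      rw [e, e] at h
      exact h
  refine hcover.trans ((subsetProb_biUnion_le hq0 hq1 _ _ _).trans ?_)
  have hterm : ∀ IJ ∈ P, subsetProb (z ^ 12 / M) V
      ({S | ((S ∩ D IJ).card : ℝ) < (1 - z⁻¹) * z ^ 12 * W IJ} ∪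
        {S | (1 + z⁻¹) * z ^ 12 * W IJ < (S ∩ D IJ).card})
      ≤ 2 * Real.exp (-(n * z ^ 10 / 3200)) := by
    rintro ⟨I, J⟩ hIJ
    simp only [hP, Finset.mem_filter, Finset.mem_product, Finset.mem_powerset] at hIJ
    obtain ⟨⟨hI, hJ⟩, hI', hJ'⟩ := hIJ
    rw [← Finset.coe_subset, Finset.coe_Icc] at hI hJ
    have hr := hV.rect I J hI hJ hI' hJ'
    rw [ncard_coe_inter subset_rfl, Finset.inter_eq_right.2 (Finset.filter_subset _ _)] at hr
    have e (c : ℝ) : c * I.card * J.card * M / n = c * M * W (I, J) := by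
      simp only [hW]; ring
    rw [e, e] at hr
    have hW0 : 0 ≤ W (I, J) := by simp only [hW]; positivity
    have hW1 : (n : ℝ) / 100 ≤ W (I, J) := by
      simp only [hW]
      rw [le_div_iff₀ hn0]
      calc (n : ℝ) / 100 * n = n / 10 * (n / 10) := by ring
        _ ≤ _ := by gcongr
    have hsub : D (I, J) ⊆ V := Finset.filter_subset _ _
    have hup := subsetProb_upper_deviation hz hV.le_density hsub hW0 hr.2
    have hlow := subsetProb_lower_deviation hz hV.le_density hsub hW0 hr.1
    have hexp : Real.exp (-(z ^ 10 * W (I, J) / 32)) ≤ Real.exp (-(n * z ^ 10 / 3200)) := by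
      apply Real.exp_le_exp.2
      have : z ^ 10 * (n / 100) ≤ z ^ 10 * W (I, J) := by gcongr
      linarith
    exact (subsetProb_union_le hq0 hq1 V _ _).trans (by linarith)
  refine (Finset.sum_le_card_nsmul _ _ _ hterm).trans ?_
  rw [nsmul_eq_mul]
  refine le_trans ?_ (four_pow_mul_exp_le hz hzn)
  gcongr
  have : P.card ≤ 4 ^ n := by
    refine (Finset.card_filter_le _ _).trans ?_
    rw [Finset.card_product, Finset.card_powerset, Int.card_Icc, ← mul_pow]
    simp
  exact_mod_cast this

end Subsample

section Conditioning

/-- The law of a random subset of `V` of density `q` conditioned on the event `E`. -/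
lemma exists_conditional_law {α : Type*} [DecidableEq α] {q : ℝ} (h0 : 0 ≤ q) (h1 : q ≤ 1)
    (V : Finset α) (E : Set (Finset α)) (hE : 0 < subsetProb q V E) :
    ∃ g : Finset α → ℝ, (∀ S, 0 ≤ g S) ∧ (∀ S, g S ≠ 0 → S ⊆ V ∧ S ∈ E) ∧
      ∑ S ∈ V.powerset, g S = 1 ∧
      ∀ T, ∑ S ∈ V.powerset with T ⊆ S, g S
        = subsetProb q V ({S | T ⊆ S} ∩ E) / subsetProb q V E := by
  classical
  set w : Finset α → ℝ := fun S => q ^ S.card * (1 - q) ^ (V \ S).card * E.indicator 1 S with hw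
  have hq : 0 ≤ 1 - q := by linarith
  have hw0 (S) : 0 ≤ w S :=
    mul_nonneg (by positivity) (indicator_nonneg (fun _ _ => zero_le_one) S)
  refine ⟨fun S => if S ⊆ V then w S / subsetProb q V E else 0, ?_, ?_, ?_, ?_⟩
  · intro S
    dsimp only
    split_ifs
    · exact div_nonneg (hw0 S) hE.le
    · exact le_rfl
  · intro S hS
    by_cases hV : S ⊆ V
    · refine ⟨hV, ?_⟩
      by_contra hSE
      simp [hw, hSE] at hS
    · simp [hV] at hS
  · have : ∑ S ∈ V.powerset, (if S ⊆ V then w S / subsetProb q V E else 0)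
        = ∑ S ∈ V.powerset, w S / subsetProb q V E :=
      Finset.sum_congr rfl fun S hS => if_pos (Finset.mem_powerset.1 hS)
    rw [this, ← Finset.sum_div]
    exact div_self hE.ne'
  · intro T
    have h : subsetProb q V ({S | T ⊆ S} ∩ E) = ∑ S ∈ V.powerset,
        q ^ S.card * (1 - q) ^ (V \ S).card * ({S | T ⊆ S} ∩ E).indicator 1 S := rfl
    rw [Finset.sum_filter, h, Finset.sum_div]
    refine Finset.sum_congr rfl fun S hS => ?_
    rw [if_pos (Finset.mem_powerset.1 hS)]
    by_cases hT : T ⊆ S <;> by_cases hSE : S ∈ E <;> simp [hw, hT, hSE]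

end Conditioning

section Subsampling

variable {n : ℕ} {z M : ℝ} {V : Finset (ℝ × ℝ)}

lemma subset_iff_subset_inter_right {α : Type*} [DecidableEq α] (T S : Finset α) :
    T ⊆ S ↔ T ⊆ S ∩ T := by
  rw [Finset.subset_inter_iff]
  exact ⟨fun h => ⟨h, subset_rfl⟩, And.left⟩

lemma IsUniformBase.card_le (hn : 0 < n) (hz : 1000 ≤ z) (hV : IsUniformBase n z M V) :
    (V.card : ℝ) ≤ 2 * n * z ^ 36 := by
  have hz0 : 0 < z := by linarith
  have hn0 : (0 : ℝ) < n := by exact_mod_cast hn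
  have hM0 : 0 < M := lt_of_lt_of_le (by positivity) hV.le_density
  have hc : (n : ℝ) / 10 ≤ (Finset.Icc (1 : ℤ) n).card := by
    rw [Int.card_Icc]
    simp
    linarith
  have h := (hV.rect (Finset.Icc 1 n) (Finset.Icc 1 n) (by simp) (by simp) hc hc).2
  rw [inter_eq_self_of_subset_left (hV.subset.trans (grid2_subset_gridRect n)),
    Set.ncard_coe_finset, Int.card_Icc] at h
  simp only [add_sub_cancel_right, Int.toNat_natCast] at h
  have hi : (z ^ 3)⁻¹ ≤ 1 := inv_le_one_of_one_le₀ (one_le_pow₀ (by linarith))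
  calc (V.card : ℝ) ≤ _ := h
    _ = (1 + (z ^ 3)⁻¹) * n * M := by field_simp
    _ ≤ (1 + 1) * n * z ^ 36 := by
      gcongr
      exact hV.density_le
    _ = _ := by ring

lemma niceAt_of_avoid {S : Finset (ℝ × ℝ)} (hz : 1000 ≤ z) (hV : IsUniformBase n z M V)
    (hS : S ⊆ V)
    (hlines : ∀ L, InLines n L → (z ^ 72)⁻¹ < lineWeight n L → lineWeight n L ≤ 1 →
      (lineTrace V L).Nonempty → ¬ BadCount z (lineWeight n L) (S ∩ lineTrace V L).card)
    (hrects : S ∉ badRects n z) : NiceAt n z S := by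
  classical
  have hz0 : 0 < z := by linarith
  have hz1 : 1 ≤ z := by linarith
  have hM0 : 0 < M := lt_of_lt_of_le (by positivity) hV.le_density
  have h1 (a b : ℕ) (hab : a ≤ b) : (z ^ b)⁻¹ ≤ (z ^ a)⁻¹ :=
    inv_anti₀ (by positivity) (pow_le_pow_right₀ hz1 hab)
  have hle1 (a : ℕ) : (z ^ a)⁻¹ ≤ 1 := inv_le_one_of_one_le₀ (one_le_pow₀ hz1)
  have hcount (L : AffineSubspace ℝ (ℝ × ℝ)) :
      ((S : Set (ℝ × ℝ)) ∩ L).ncard = (S ∩ lineTrace V L).card := ncard_coe_inter hS _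
  have hempty (L : AffineSubspace ℝ (ℝ × ℝ)) (h : ¬ (lineTrace V L).Nonempty) :
      (S ∩ lineTrace V L).card = 0 := by
    rw [Finset.not_nonempty_iff_eq_empty.1 h, Finset.inter_empty, Finset.card_empty]
  refine ⟨(Finset.coe_subset.2 hS).trans hV.subset, ?_, ?_, ?_, ?_⟩
  · intro L hL hw hw1
    have hw24 := (h1 8 24 (by norm_num)).trans_lt hw
    by_cases hne : (lineTrace V L).Nonempty
    · have hb := hlines L hL ((h1 24 72 (by norm_num)).trans_lt hw24) hw1 hne
      rw [hcount]
      constructor <;> by_contra! h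
      · exact hb (Or.inr (Or.inr ⟨hw, Or.inl h⟩))
      · exact hb (Or.inr (Or.inr ⟨hw, Or.inr h⟩))
    · exfalso
      have h := (hV.heavy L hL hw24 hw1).1
      rw [← card_lineTrace, Finset.not_nonempty_iff_eq_empty.1 hne] at h
      have hlt : (z ^ 3)⁻¹ < 1 := inv_lt_one_of_one_lt₀ (one_lt_pow₀ (by linarith) (by norm_num))
      have hpos : 0 < lineWeight n L := lt_trans (by positivity) hw
      have : 0 < (1 - (z ^ 3)⁻¹) * M * lineWeight n L :=
        mul_pos (mul_pos (by linarith) hM0) hpos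
      simp at h
      linarith
  · intro L hL hw hw8
    rw [hcount]
    by_cases hne : (lineTrace V L).Nonempty
    · have hb := hlines L hL ((h1 24 72 (by norm_num)).trans_lt hw) (hw8.trans (hle1 8)) hne
      by_contra! h
      exact hb (Or.inr (Or.inl ⟨hw, hw8, h⟩))
    · rw [hempty L hne]
      simp only [Nat.cast_zero]
      positivity
  · intro L hL hw
    rcases le_or_gt (lineWeight n L) (z ^ 72)⁻¹ with h72 | h72
    · refine le_trans ?_ (hV.light L hL h72)
      rw [hcount, ← card_lineTrace]
      exact Finset.card_le_card Finset.inter_subset_right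
    · rw [hcount]
      by_cases hne : (lineTrace V L).Nonempty
      · have hb := hlines L hL h72 (hw.trans (hle1 24)) hne
        by_contra! h
        exact hb (Or.inl ⟨hw, h⟩)
      · rw [hempty L hne]
        norm_num
  · intro I J hI hJ hI' hJ'
    constructor <;> by_contra! h
    · exact hrects ⟨I, J, hI, hJ, hI', hJ', Or.inl h⟩
    · exact hrects ⟨I, J, hI, hJ, hI', hJ', Or.inr h⟩

lemma one_sub_pow_le_one_sub_pow {x : ℝ} {K c t : ℕ} (hz : 1 ≤ z) (h0 : 0 ≤ x) (h1 : x ≤ 1 / 4)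
    (hK : x * K ≤ 1 / 10 ^ 4 * (z ^ 36)⁻¹) (hc : c ≤ t * K) :
    (1 - 1 / (8 * z ^ 12)) ^ t ≤ (1 - x) ^ c := by
  have hz12 : 1 ≤ z ^ 12 := one_le_pow₀ hz
  have hz0 : 0 < z := by linarith
  set s : ℝ := 1 / (8 * z ^ 12) with hs
  have hs0 : 0 < s := by positivity
  have hs1 : s ≤ 1 := by
    rw [hs, div_le_one (by positivity)]
    linarith
  have h36 : (z ^ 36)⁻¹ ≤ (z ^ 12)⁻¹ :=
    inv_anti₀ (by positivity) (pow_le_pow_right₀ hz (by norm_num))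
  have h8 : (z ^ 12)⁻¹ = 8 * s := by rw [hs]; field_simp
  have hxc : x * c ≤ t * (s / 2) := by
    have hc' : (c : ℝ) ≤ t * K := by exact_mod_cast hc
    calc x * c ≤ x * (t * K) := by gcongr
      _ = t * (x * K) := by ring
      _ ≤ t * (s / 2) := mul_le_mul_of_nonneg_left (by linarith) (by positivity)
  refine le_trans ?_ (exp_neg_le_one_sub_pow h0 h1 hxc)
  have h3 : Real.exp (-(2 * (t * (s / 2)))) = Real.exp (-s) ^ t := by
    rw [← Real.exp_nat_mul]; congr 1; ring
  rw [h3]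
  exact pow_le_pow_left₀ (by linarith) (by linarith [Real.add_one_le_exp (-s)]) t

lemma le_mul_pow_of_conditional {q s W Y G Z : ℝ} {t : ℕ} (hq : 0 ≤ q) (hs0 : 0 ≤ s)
    (hs1 : s ≤ 1 / 8) (ht : 0 < t) (hY : 0 ≤ Y) (hW : (1 - s) ^ t ≤ W)
    (hWY : W * Y ≤ q ^ t * G) (hZ : (1 - s) * G ≤ Z) :
    Y ≤ (q * (1 + 4 * s)) ^ t * Z := by
  have h1s : 0 ≤ 1 - s := by linarith
  have hr : 1 ≤ (1 + 4 * s) * ((1 - s) * (1 - s)) := by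
    nlinarith [mul_nonneg hs0 (by linarith : 0 ≤ 2 - 7 * s), pow_nonneg hs0 3]
  have hpow : (1 - s) ^ t ≤ 1 - s := pow_le_of_le_one h1s (by linarith) ht.ne'
  calc Y ≤ ((1 + 4 * s) * ((1 - s) * (1 - s))) ^ t * Y :=
        le_mul_of_one_le_left hY (one_le_pow₀ hr)
    _ = (1 + 4 * s) ^ t * (1 - s) ^ t * ((1 - s) ^ t * Y) := by
      rw [mul_pow, mul_pow]; ring
    _ ≤ (1 + 4 * s) ^ t * (1 - s) * (W * Y) := by gcongr
    _ ≤ (1 + 4 * s) ^ t * (1 - s) * (q ^ t * G) := by gcongr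
    _ = (q * (1 + 4 * s)) ^ t * ((1 - s) * G) := by rw [mul_pow]; ring
    _ ≤ _ := by gcongr

/-- A random subset of a regular set, conditioned on being nice, is spread. -/
theorem exists_spread_subsample (hn : 0 < n) (hz : 1000 ≤ z) (hzn : z ^ 12 ≤ n)
    (hV : IsUniformBase n z M V) :
    ∃ g : Finset (ℝ × ℝ) → ℝ, (∀ S, 0 ≤ g S) ∧ (∀ S, g S ≠ 0 → S ⊆ V ∧ NiceAt n z S) ∧
      ∑ S ∈ V.powerset, g S = 1 ∧
      ∀ T ⊆ V, ∑ S ∈ V.powerset with T ⊆ S, g S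
        ≤ (z ^ 12 / M * (1 + 1 / (2 * z ^ 12))) ^ T.card := by
  classical
  have hz0 : 0 < z := by linarith
  have hz1 : 1 ≤ z := by linarith
  have hn0 : (0 : ℝ) < n := by exact_mod_cast hn
  have hM0 : 0 < M := lt_of_lt_of_le (by positivity) hV.le_density
  set q := z ^ 12 / M with hq
  have hq0 : 0 ≤ q := by positivity
  have hq1 : q ≤ 1 := (div_le_one hM0).2 hV.le_density
  set x : ℝ := 1 / 10 ^ 6 * (z ^ 180)⁻¹ with hx
  have hx0 : 0 ≤ x := by positivity
  have hx4 : x ≤ 1 / 4 := by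
    have : (z ^ 180)⁻¹ ≤ 1 := inv_le_one_of_one_le₀ (one_le_pow₀ hz1)
    rw [hx]
    linarith
  set B := ⌊2 * z ^ 72⌋₊ with hB
  choose F hFcard hF using exists_finset_lines_through n B
  set K : ℕ := (2 * B + 1) ^ 2 with hK
  have hKle : (K : ℝ) ≤ 25 * z ^ 144 := by
    have h1 : (B : ℝ) ≤ 2 * z ^ 72 := Nat.floor_le (by positivity)
    have h2 : 1 ≤ z ^ 72 := one_le_pow₀ hz1
    rw [hK]
    push_cast
    calc (2 * (B : ℝ) + 1) ^ 2 ≤ (2 * (2 * z ^ 72) + z ^ 72) ^ 2 := by gcongr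
      _ = _ := by ring
  set I := (V.biUnion F).filter fun L =>
    InLines n L ∧ (z ^ 72)⁻¹ < lineWeight n L ∧ lineWeight n L ≤ 1 with hI
  set A : AffineSubspace ℝ (ℝ × ℝ) → Set (Finset (ℝ × ℝ)) := fun L =>
    {S | BadCount z (lineWeight n L) (S ∩ lineTrace V L).card} with hA
  have hmemF {L} (hL : InLines n L) (hw : (z ^ 72)⁻¹ < lineWeight n L) {p : ℝ × ℝ}
      (hp : p ∈ lineTrace V L) : L ∈ F p := by
    refine hF p L hL (Finset.mem_filter.1 hp).2 ?_
    have h1 : 2 * z ^ 72 < B + 1 := Nat.lt_floor_add_one _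
    rw [lineWeight, lt_div_iff₀ hn0, inv_mul_lt_iff₀ (by positivity)] at hw
    have hk : (0 : ℝ) < (grid2 n ∩ (L : Set (ℝ × ℝ))).ncard := by
      exact_mod_cast lt_of_lt_of_le (by norm_num) hL.2
    have : (2 * n : ℝ) < (B + 1) * (grid2 n ∩ (L : Set (ℝ × ℝ))).ncard := by
      calc (2 * n : ℝ) < 2 * (z ^ 72 * (grid2 n ∩ (L : Set (ℝ × ℝ))).ncard) := by linarith
        _ = 2 * z ^ 72 * (grid2 n ∩ (L : Set (ℝ × ℝ))).ncard := by ring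
        _ ≤ _ := by gcongr
    exact_mod_cast this
  have hmemI {L} (h : L ∈ I) :
      InLines n L ∧ (z ^ 72)⁻¹ < lineWeight n L ∧ lineWeight n L ≤ 1 :=
    (Finset.mem_filter.1 h).2
  have hDV : ∀ L ∈ I, lineTrace V L ⊆ V := fun L _ => Finset.filter_subset _ _
  have hAD : ∀ L ∈ I, ∀ S, S ∈ A L ↔ S ∩ lineTrace V L ∈ A L := by
    intro L _ S
    simp only [hA, mem_ofPred_eq, Finset.inter_assoc, Finset.inter_self]
  have htouch (C : Finset (ℝ × ℝ)) : (touching (lineTrace V) I C).card ≤ C.card * K := by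
    have hsub : touching (lineTrace V) I C ⊆ C.biUnion F := by
      intro L hL
      obtain ⟨hLI, hd⟩ := Finset.mem_filter.1 hL
      obtain ⟨p, hpC, hp⟩ := Finset.not_disjoint_iff.1 hd
      exact Finset.mem_biUnion.2 ⟨p, hpC, hmemF (hmemI hLI).1 (hmemI hLI).2.1 hp⟩
    exact (Finset.card_le_card hsub).trans
      (Finset.card_biUnion_le_card_mul _ _ _ fun p _ => hFcard p)
  have hxK : x * K ≤ 1 / 10 ^ 4 * (z ^ 36)⁻¹ := by
    calc x * K ≤ x * (25 * z ^ 144) := by gcongr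
      _ = 25 / 10 ^ 6 * (z ^ 36)⁻¹ := by rw [hx]; field_simp
      _ ≤ _ := mul_le_mul_of_nonneg_right (by norm_num) (by positivity)
  have hdeg : ∀ L ∈ I, ((touching (lineTrace V) I (lineTrace V L)).card : ℝ) * x ≤ 1 / 2 := by
    intro L hL
    obtain ⟨hL1, hw, hw1⟩ := hmemI hL
    have h1 : ((touching (lineTrace V) I (lineTrace V L)).card : ℝ) ≤ (lineTrace V L).card * K := by
      exact_mod_cast htouch _
    have h2 := hV.card_lineTrace_le hz hL1 hw hw1
    calc _ ≤ (lineTrace V L).card * K * x := by gcongr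
      _ = (lineTrace V L).card * (x * K) := by ring
      _ ≤ 2 * z ^ 36 * (1 / 10 ^ 4 * (z ^ 36)⁻¹) := by gcongr
      _ = 2 / 10 ^ 4 := by field_simp
      _ ≤ _ := by norm_num
  have hP : ∀ L ∈ I, subsetProb q V (A L) ≤ x / 2 := fun L hL =>
    hV.prob_badCount_le hz (hmemI hL).1 (hmemI hL).2.1 (hmemI hL).2.2
  have hx1 : x ≤ 1 := by linarith
  have hIcard : x * I.card ≤ n / 2 := by
    have h1 : (I.card : ℝ) ≤ V.card * K := by
      exact_mod_cast (Finset.card_filter_le _ _).trans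
        (Finset.card_biUnion_le_card_mul _ _ _ fun p _ => hFcard p)
    calc x * I.card ≤ x * (V.card * K) := by gcongr
      _ = V.card * (x * K) := by ring
      _ ≤ 2 * n * z ^ 36 * (1 / 10 ^ 4 * (z ^ 36)⁻¹) := by
        gcongr
        exact hV.card_le hn hz
      _ = n * (2 / 10 ^ 4) := by field_simp
      _ ≤ _ := by linarith
  have hG := local_lemma_prob_avoid hq0 hq1 hx0 hx1 hDV hAD hdeg hP
  have hG' : Real.exp (-n) ≤ subsetProb q V (avoid A I) := by
    refine le_trans ?_ ((exp_neg_le_one_sub_pow hx0 hx4 hIcard).trans hG)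
    apply Real.exp_le_exp.2
    linarith
  set G := subsetProb q V (avoid A I) with hGdef
  have hGpos : 0 < G := (Real.exp_pos _).trans_le hG'
  set Z := subsetProb q V (avoid A I \ badRects n z) with hZ
  have hrect := hV.prob_badRects_le hn hz hzn
  have hZG : (1 - 1 / (8 * z ^ 12)) * G ≤ Z := by
    have h1 := subsetProb_inter_add_diff q V (avoid A I) (badRects n z)
    have h2 : subsetProb q V (avoid A I ∩ badRects n z) ≤ subsetProb q V (badRects n z) :=
      subsetProb_mono hq0 hq1 fun S _ hS => hS.2
    have h3 : 1 / (8 * z ^ 12) * Real.exp (-n) ≤ 1 / (8 * z ^ 12) * G := by gcongr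
    linarith
  have hz12 : 1 ≤ z ^ 12 := one_le_pow₀ hz1
  set s : ℝ := 1 / (8 * z ^ 12) with hs
  have hs0 : 0 < s := by positivity
  have hs1 : s ≤ 1 / 8 := by
    rw [hs]
    gcongr
    linarith
  have hZpos : 0 < Z := lt_of_lt_of_le (mul_pos (by linarith) hGpos) hZG
  obtain ⟨g, hg0, hgS, hg1, hgT⟩ := exists_conditional_law hq0 hq1 V _ hZpos
  refine ⟨g, hg0, ?_, hg1, ?_⟩
  · intro S hS
    obtain ⟨hSV, hSI, hSR⟩ := hgS S hS
    refine ⟨hSV, niceAt_of_avoid hz hV hSV ?_ hSR⟩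
    rintro L hL hw hw1 ⟨p, hp⟩
    refine hSI L (Finset.mem_filter.2 ⟨Finset.mem_biUnion.2 ⟨p, ?_, hmemF hL hw hp⟩, hL, hw, hw1⟩)
    exact (Finset.mem_filter.1 hp).1
  · intro T hT
    rw [hgT T, ← hZ]
    rcases Nat.eq_zero_or_pos T.card with hT0 | hTpos
    · rw [hT0, pow_zero]
      refine (div_le_one hZpos).2 (subsetProb_mono hq0 hq1 fun S _ hS => hS.2)
    have hcond := local_lemma_conditional hq0 hq1 hx0 hx1 hDV hAD hdeg hP hT
      (E := {S | T ⊆ S}) (fun S => (subset_iff_subset_inter_right T S).trans Iff.rfl)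
    rw [subsetProb_superset q hT] at hcond
    have hc := one_sub_pow_le_one_sub_pow hz1 hx0 hx4 hxK (htouch T)
    have hYle : subsetProb q V ({S | T ⊆ S} ∩ (avoid A I \ badRects n z))
        ≤ subsetProb q V ({S | T ⊆ S} ∩ avoid A I) :=
      subsetProb_mono hq0 hq1 fun S _ hS => ⟨hS.1, hS.2.1⟩
    have h4s : 1 / (2 * z ^ 12) = 4 * s := by rw [hs]; field_simp; norm_num
    rw [div_le_iff₀ hZpos, h4s]
    exact hYle.trans (le_mul_pow_of_conditional hq0 hs0.le hs1 hTpos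
      (subsetProb_nonneg hq0 hq1 V _) hc hcond hZG)

end Subsampling

section NiceLaw

/-- `f` is the mass function of a spread probability law on nice subsets of the grid, for the
parameter `m = z ^ 12`. -/
structure IsNiceLaw (n : ℕ) (z : ℝ) (f : Finset (ℝ × ℝ) → ℝ) : Prop where
  nonneg : ∀ S, 0 ≤ f S
  support : ∀ S, f S ≠ 0 → S ⊆ gridFinset n ∧ NiceAt n z S
  sum_eq_one : ∑ S ∈ (gridFinset n).powerset, f S = 1
  spread : ∀ T ⊆ gridFinset n,
    ∑ S ∈ (gridFinset n).powerset with T ⊆ S, f S ≤ ((z ^ 12 + 1) / n) ^ T.card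

lemma sum_powerset_filter_of_support {α : Type*} {V W : Finset α} (hVW : V ⊆ W)
    {g : Finset α → ℝ} (hg : ∀ S, g S ≠ 0 → S ⊆ V) (p : Finset α → Prop) [DecidablePred p] :
    ∑ S ∈ W.powerset with p S, g S = ∑ S ∈ V.powerset with p S, g S := by
  refine (Finset.sum_subset (Finset.filter_subset_filter _ (Finset.powerset_mono.2 hVW)) ?_).symm
  intro S hS hS'
  by_contra h
  exact hS' (Finset.mem_filter.2 ⟨Finset.mem_powerset.2 (hg S h), (Finset.mem_filter.1 hS).2⟩)

lemma exists_isNiceLaw_of_le {n : ℕ} {z : ℝ} (hn : 0 < n) (hz : 1000 ≤ z) (hzn : z ^ 12 ≤ n)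
    (hnz : n ≤ z ^ 36) : ∃ f, IsNiceLaw n z f := by
  have hn0 : (0 : ℝ) < n := by exact_mod_cast hn
  have hz0 : 0 < z := by linarith
  have hbase : IsUniformBase n z n (gridFinset n : Set (ℝ × ℝ)) := by
    rw [coe_gridFinset]
    exact isUniformBase_grid hn (by linarith) hzn hnz
  obtain ⟨g, h0, hS, h1, hT⟩ := exists_spread_subsample hn hz hzn hbase
  refine ⟨g, h0, hS, h1, fun T hTV => (hT T hTV).trans ?_⟩
  refine pow_le_pow_left₀ (by positivity) ?_ _
  rw [div_mul_eq_mul_div]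
  gcongr
  rw [mul_add, mul_one, mul_one_div, div_eq_mul_inv, mul_inv, mul_comm 2⁻¹, ← mul_assoc,
    mul_inv_cancel₀ (by positivity)]
  norm_num

lemma IsNiceLaw.exists_subsample {n : ℕ} {z : ℝ} (hn : 0 < n) (hz : 1000 ≤ z) (hzn : z ^ 12 ≤ n)
    {f : Finset (ℝ × ℝ) → ℝ} (hf : IsNiceLaw n (z ^ 3) f) : ∃ f', IsNiceLaw n z f' := by
  have hn0 : (0 : ℝ) < n := by exact_mod_cast hn
  have hz0 : 0 < z := by linarith
  have hex (V : Finset (ℝ × ℝ)) : ∃ g : Finset (ℝ × ℝ) → ℝ, f V ≠ 0 →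
      (∀ S, 0 ≤ g S) ∧ (∀ S, g S ≠ 0 → S ⊆ V ∧ NiceAt n z S) ∧ ∑ S ∈ V.powerset, g S = 1 ∧
      ∀ T ⊆ V, ∑ S ∈ V.powerset with T ⊆ S, g S
        ≤ (z ^ 12 / z ^ 36 * (1 + 1 / (2 * z ^ 12))) ^ T.card := by
    by_cases h : f V = 0
    · exact ⟨0, fun h' => absurd h h'⟩
    · obtain ⟨g, hg⟩ := exists_spread_subsample hn hz hzn
        ((hf.support V h).2.isUniformBase (by linarith))
      exact ⟨g, fun _ => hg⟩
  choose g hg using hex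
  set P := (gridFinset n).powerset with hP
  have hsum (p : Finset (ℝ × ℝ) → Prop) [DecidablePred p] :
      ∑ S ∈ P with p S, ∑ V ∈ P, f V * g V S
        = ∑ V ∈ P, f V * ∑ S ∈ V.powerset with p S, g V S := by
    rw [Finset.sum_comm]
    refine Finset.sum_congr rfl fun V _ => ?_
    rw [← Finset.mul_sum]
    by_cases h : f V = 0
    · simp [h]
    · rw [sum_powerset_filter_of_support (hf.support V h).1 fun S hS => ((hg V h).2.1 S hS).1]
  refine ⟨fun S => ∑ V ∈ P, f V * g V S, ?_, ?_, ?_, ?_⟩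
  · intro S
    refine Finset.sum_nonneg fun V _ => ?_
    by_cases h : f V = 0
    · simp [h]
    · exact mul_nonneg (hf.nonneg V) ((hg V h).1 S)
  · intro S hS
    obtain ⟨V, -, hV⟩ := Finset.exists_ne_zero_of_sum_ne_zero hS
    have h := (hg V (left_ne_zero_of_mul hV)).2.1 S (right_ne_zero_of_mul hV)
    exact ⟨h.1.trans (hf.support V (left_ne_zero_of_mul hV)).1, h.2⟩
  · have h := hsum fun _ => True
    simp only [Finset.filter_true] at h
    rw [h, ← hf.sum_eq_one]
    refine Finset.sum_congr rfl fun V _ => ?_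
    by_cases h : f V = 0
    · simp [h]
    · rw [(hg V h).2.2.1, mul_one]
  · intro T hT
    rw [hsum]
    set r := z ^ 12 / z ^ 36 * (1 + 1 / (2 * z ^ 12)) with hr
    have hr0 : 0 ≤ r := by positivity
    calc ∑ V ∈ P, f V * ∑ S ∈ V.powerset with T ⊆ S, g V S
        ≤ ∑ V ∈ P, if T ⊆ V then f V * r ^ T.card else 0 := by
          refine Finset.sum_le_sum fun V _ => ?_
          split_ifs with hTV
          · by_cases h : f V = 0
            · simp [h]
            · exact mul_le_mul_of_nonneg_left ((hg V h).2.2.2 T hTV) (hf.nonneg V)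
          · rw [Finset.filter_false_of_mem, Finset.sum_empty, mul_zero]
            exact fun S hS hTS => hTV (hTS.trans (Finset.mem_powerset.1 hS))
      _ = (∑ V ∈ P with T ⊆ V, f V) * r ^ T.card := by
          rw [← Finset.sum_filter, Finset.sum_mul]
      _ ≤ (((z ^ 3) ^ 12 + 1) / n) ^ T.card * r ^ T.card := by
          gcongr
          exact hf.spread T hT
      _ = (((z ^ 3) ^ 12 + 1) / n * r) ^ T.card := (mul_pow _ _ _).symm
      _ ≤ ((z ^ 12 + 1) / n) ^ T.card := by
          refine pow_le_pow_left₀ (by positivity) ?_ _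
          rw [div_mul_eq_mul_div]
          gcongr
          have hy : (4 : ℝ) ≤ z ^ 12 := (by norm_num : (4 : ℝ) ≤ 1000 ^ 12).trans (by gcongr)
          have h3 : (z ^ 3) ^ 12 = (z ^ 12) ^ 3 := by ring
          have h36 : z ^ 36 = (z ^ 12) ^ 3 := by ring
          rw [hr, h3, h36]
          generalize z ^ 12 = y at hy
          have hy0 : 0 < y := by linarith
          have e : (y ^ 3 + 1) * (y / y ^ 3 * (1 + 1 / (2 * y)))
              = ((y ^ 3 + 1) * (2 * y + 1)) / (2 * y ^ 3) := by field_simp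
          rw [e, div_le_iff₀ (by positivity)]
          nlinarith [mul_le_mul hy hy (by norm_num) hy0.le, pow_pos hy0 2, pow_pos hy0 3]

lemma exists_isNiceLaw {n : ℕ} (hn : 0 < n) (j : ℕ) {z : ℝ} (hz : 1000 ≤ z) (hzn : z ^ 12 ≤ n)
    (hj : (n : ℝ) ≤ (z ^ 36) ^ 3 ^ j) : ∃ f, IsNiceLaw n z f := by
  induction j generalizing z with
  | zero => exact exists_isNiceLaw_of_le hn hz hzn (by simpa using hj)
  | succ j ih =>
    rcases le_total (n : ℝ) (z ^ 36) with h | h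
    · exact exists_isNiceLaw_of_le hn hz hzn h
    · obtain ⟨f, hf⟩ := ih (z := z ^ 3) (hz.trans (le_self_pow₀ (by linarith) (by norm_num)))
        (by rw [← pow_mul]; exact h)
        (by rwa [← pow_mul z, mul_comm, pow_mul z, ← pow_mul _ 3, ← pow_succ'])
      exact hf.exists_subsample hn hz hzn

end NiceLaw

/-- For every positive integer `n` and real `10^36 ≤ m ≤ n`, there exists an
`((m+1)/n)`-spread probability distribution over subsets of `[n]²` supported on `m`-nice sets. -/
theorem spread_nice_exists (n : ℕ) (hn : 0 < n) (m : ℝ) (hm : 10 ^ 36 ≤ m) (hmn : m ≤ (n : ℝ)) :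
    ∃ μ : PMF (Finset (ℝ × ℝ)),
      IsSpread n ((m + 1) / n) μ ∧ SupportedOnNice n m μ := by
  classical
  have hm0 : 0 ≤ m := le_trans (by norm_num) hm
  obtain ⟨z, hz, rfl⟩ : ∃ z : ℝ, 1000 ≤ z ∧ z ^ 12 = m := by
    refine ⟨m ^ ((12 : ℕ) : ℝ)⁻¹, ?_, Real.rpow_inv_natCast_pow hm0 (by norm_num)⟩
    refine le_of_pow_le_pow_left₀ (n := 12) (by norm_num) (by positivity) ?_
    rw [Real.rpow_inv_natCast_pow hm0 (by norm_num)]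
    exact le_trans (by norm_num) hm
  have hn2 : (n : ℝ) ≤ (z ^ 36) ^ 3 ^ n := by
    have h2 : (2 : ℝ) ≤ z ^ 36 := (by linarith : (2 : ℝ) ≤ z).trans
      (le_self_pow₀ (by linarith) (by norm_num))
    have h3 : n ≤ 3 ^ n := (Nat.lt_pow_self (by norm_num)).le
    calc (n : ℝ) ≤ 2 ^ n := by exact_mod_cast (Nat.lt_two_pow_self (n := n)).le
      _ ≤ (z ^ 36) ^ n := by gcongr
      _ ≤ _ := pow_le_pow_right₀ (by linarith) h3
  obtain ⟨f, hf⟩ := exists_isNiceLaw hn n hz hmn hn2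
  have hout : ∀ S ∉ (gridFinset n).powerset, ENNReal.ofReal (f S) = 0 := by
    intro S hS
    by_contra h
    exact hS (Finset.mem_powerset.2 (hf.support S fun h0 => h (by rw [h0, ENNReal.ofReal_zero])).1)
  have hsum : ∑ S ∈ (gridFinset n).powerset, ENNReal.ofReal (f S) = 1 := by
    rw [← ENNReal.ofReal_sum_of_nonneg fun S _ => hf.nonneg S, hf.sum_eq_one, ENNReal.ofReal_one]
  refine ⟨PMF.ofFinset (fun S => ENNReal.ofReal (f S)) _ hsum hout, ?_, ?_⟩
  · intro T hT
    have hTG : T ⊆ gridFinset n := by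
      rwa [← coe_gridFinset, Finset.coe_subset] at hT
    rw [PMF.toOuterMeasure_ofFinset_apply, tsum_eq_sum (s := (gridFinset n).powerset)
      fun S hS => by simp [indicator, hout S hS]]
    simp only [indicator_apply, mem_ofPred_eq]
    rw [← Finset.sum_filter, ← ENNReal.ofReal_sum_of_nonneg fun S _ => hf.nonneg S,
      ENNReal.toReal_ofReal (Finset.sum_nonneg fun S _ => hf.nonneg S)]
    exact hf.spread T hTG
  · intro S hS
    rw [isNice_pow_twelve_iff (by linarith)]
    refine (hf.support S fun h0 => hS ?_).2
    rw [PMF.ofFinset_apply, h0, ENNReal.ofReal_zero]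
end
end

section
/- Let n and k be integers with 10^36 ≤ k ≤ n and set ε = 0.005. Let μ be a (((1+ε)k+1)/n)-spread probability distribution over subsets of [n]² supported on (1+ε)k-nice sets, and let S be a random sample from μ. Then with positive probability there exists a subset S' ⊆ S that contains exactly k points on each horizontal line {(x, c) : x ∈ ℝ} with c ∈ {1,…,n} and exactly k points on each vertical line {(c, y) : y ∈ ℝ} with c ∈ {1,…,n}. -/
open Set

noncomputable section

/-- A bipartite graph with parts of equal size has a `k`-factor under Ore's cut condition. -/
theorem exists_regular_subset {A B : Type*} [Fintype A] [Fintype B] [DecidableEq A]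
    [DecidableEq B] (k : ℕ) (hAB : Fintype.card A = Fintype.card B) (E : Finset (A × B))
    (hE : ∀ (X : Finset A) (Z : Finset B),
      k * X.card ≤ (E ∩ X ×ˢ Zᶜ).card + k * Z.card) :
    ∃ F ⊆ E, (∀ a, (F.filter fun p => p.1 = a).card = k) ∧
      ∀ b, (F.filter fun p => p.2 = b).card = k := by
  let t : (A × Fin k) ⊕ E → Finset ((B × Fin k) ⊕ E) := fun v => match v with
    | .inl (a, _) => Finset.univ.filter fun w => ∃ e : E, e.1.1 = a ∧ w = .inr e
    | .inr e => Finset.univ.filter fun w => w = .inr e ∨ ∃ j, w = .inl (e.1.2, j)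
  have tl (a i w) : w ∈ t (.inl (a, i)) ↔ ∃ e : E, e.1.1 = a ∧ w = .inr e := by simp [t]
  have tr (e w) : w ∈ t (.inr e) ↔ w = .inr e ∨ ∃ j, w = .inl (e.1.2, j) := by simp [t]
  have hall : ∀ s : Finset ((A × Fin k) ⊕ E), s.card ≤ (s.biUnion t).card := by
    intro s
    set X : Finset A := s.toLeft.image Prod.fst
    set W : Finset E := s.toRight
    set Z : Finset B := W.image fun e => e.1.2
    have h1 : s.card ≤ k * X.card + W.card := by
      rw [← Finset.card_toLeft_add_card_toRight]
      refine Nat.add_le_add_right ?_ _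
      calc s.toLeft.card ≤ (X ×ˢ (Finset.univ : Finset (Fin k))).card := by
            apply Finset.card_le_card
            intro p hp
            simp only [Finset.mem_product, Finset.mem_univ, and_true]
            exact Finset.mem_image_of_mem _ hp
        _ = k * X.card := by simp [mul_comm]
    have h2 : ((Z ×ˢ (Finset.univ : Finset (Fin k))).disjSum
        (W ∪ Finset.univ.filter fun e : E => e.1.1 ∈ X ∧ e.1.2 ∉ Z)) ⊆ s.biUnion t := by
      intro w hw
      rw [Finset.mem_biUnion]
      rcases w with ⟨b, j⟩ | e
      · simp only [Finset.inl_mem_disjSum, Finset.mem_product, Finset.mem_univ, and_true, Z,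
          Finset.mem_image] at hw
        obtain ⟨e, he, rfl⟩ := hw
        exact ⟨.inr e, by simpa [W] using he, (tr _ _).2 (.inr ⟨j, rfl⟩)⟩
      · simp only [Finset.inr_mem_disjSum, Finset.mem_union, Finset.mem_filter,
          Finset.mem_univ, true_and] at hw
        rcases hw with he | ⟨he, -⟩
        · exact ⟨.inr e, by simpa [W] using he, (tr _ _).2 (.inl rfl)⟩
        · obtain ⟨⟨a, i⟩, hai, h⟩ := Finset.mem_image.1 he
          exact ⟨.inl (a, i), by simpa using hai, (tl a i _).2 ⟨e, h.symm, rfl⟩⟩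
    have h3 : (Finset.univ.filter fun e : E => e.1.1 ∈ X ∧ e.1.2 ∉ Z).card
        = (E ∩ X ×ˢ Zᶜ).card := by
      rw [← Finset.card_map (Function.Embedding.subtype _)]
      congr 1
      ext p
      simp
      tauto
    have h4 : Disjoint W (Finset.univ.filter fun e : E => e.1.1 ∈ X ∧ e.1.2 ∉ Z) := by
      rw [Finset.disjoint_left]
      intro e he h
      simp only [Finset.mem_filter, Finset.mem_univ, true_and] at h
      exact h.2 (Finset.mem_image_of_mem _ he)
    have h5 := Finset.card_le_card h2
    rw [Finset.card_disjSum, Finset.card_union_of_disjoint h4, h3, Finset.card_product,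
      Finset.card_univ, Fintype.card_fin] at h5
    have := hE X Z
    rw [mul_comm k Z.card] at this
    omega
  obtain ⟨f, hf, hft⟩ := (Finset.all_card_le_biUnion_card_iff_exists_injective t).1 hall
  have hbij : Function.Bijective f := by
    rw [Fintype.bijective_iff_injective_and_card]
    exact ⟨hf, by simp [hAB]⟩
  have hl (a i) := (tl a i _).1 (hft (.inl (a, i)))
  choose g hga hg using hl
  have hginj (a i a' i') (h : g a i = g a' i') : a = a' ∧ i = i' := by
    have : f (.inl (a, i)) = f (.inl (a', i')) := by rw [hg, hg, h]
    simpa using hf this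
  have hM (e : E) : (∃ a i, g a i = e) ↔ ∃ j, f (.inr e) = .inl (e.1.2, j) := by
    constructor
    · rintro ⟨a, i, rfl⟩
      refine ((tr _ _).1 (hft (.inr (g a i)))).resolve_left fun h => ?_
      rw [← hg] at h
      simpa using hf h
    · rintro ⟨j, hj⟩
      obtain ⟨⟨a, i⟩ | e', he'⟩ := hbij.2 (.inr e)
      · exact ⟨a, i, Sum.inr_injective ((hg a i).symm.trans he')⟩
      · rcases (tr _ _).1 (hft (.inr e')) with h | ⟨j', h⟩
        · rw [h] at he'
          obtain rfl := Sum.inr_injective he'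
          rw [hj] at h
          cases h
        · rw [h] at he'
          cases he'
  refine ⟨Finset.univ.image fun q : A × Fin k => (g q.1 q.2).1, ?_, fun a => ?_, fun b => ?_⟩
  · intro p hp
    obtain ⟨q, -, rfl⟩ := Finset.mem_image.1 hp
    exact (g q.1 q.2).2
  · have : ((Finset.univ.image fun q : A × Fin k => (g q.1 q.2).1).filter fun p => p.1 = a)
        = Finset.univ.image fun i : Fin k => (g a i).1 := by
      ext p
      simp only [Finset.mem_filter, Finset.mem_image, Finset.mem_univ, true_and, Prod.exists]
      constructor
      · rintro ⟨⟨a', i, rfl⟩, h⟩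
        rw [hga] at h
        exact ⟨i, by rw [h]⟩
      · rintro ⟨i, rfl⟩
        exact ⟨⟨a, i, rfl⟩, hga a i⟩
    rw [this, Finset.card_image_of_injective, Finset.card_univ, Fintype.card_fin]
    exact fun i i' h => (hginj _ _ _ _ (Subtype.ext h)).2
  · have hr (j : Fin k) : ∃ e : E, f (.inr e) = .inl (b, j) ∧ e.1.2 = b := by
      obtain ⟨⟨a, i⟩ | e, he⟩ := hbij.2 (.inl (b, j))
      · rw [hg] at he
        cases he
      · rcases (tr _ _).1 (hft (.inr e)) with h | ⟨j', h⟩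
        · rw [h] at he
          cases he
        · refine ⟨e, he, ?_⟩
          rw [h] at he
          simpa using congrArg (Sum.map Prod.fst id) he
    choose r hr hrb using hr
    have : ((Finset.univ.image fun q : A × Fin k => (g q.1 q.2).1).filter fun p => p.2 = b)
        = Finset.univ.image fun j : Fin k => (r j).1 := by
      ext p
      simp only [Finset.mem_filter, Finset.mem_image, Finset.mem_univ, true_and, Prod.exists]
      constructor
      · rintro ⟨⟨a, i, rfl⟩, h⟩
        obtain ⟨j, hj⟩ := (hM (g a i)).1 ⟨a, i, rfl⟩
        rw [h, ← hr] at hj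
        exact ⟨j, congrArg Subtype.val (Sum.inr_injective (hf hj)).symm⟩
      · rintro ⟨j, rfl⟩
        obtain ⟨a, i, h⟩ := (hM (r j)).2 ⟨j, by rw [hr, hrb]⟩
        exact ⟨⟨a, i, by rw [h]⟩, hrb j⟩
    rw [this, Finset.card_image_of_injective, Finset.card_univ, Fintype.card_fin]
    intro j j' h
    have h1 := hr j
    rw [Subtype.ext h, hr j'] at h1
    simpa using h1.symm

/-- The cut condition for a small set `X`, from degree bounds and sparsity between small sets of
equal size. -/
theorem cut_condition_of_small {A B : Type*} [Fintype A] [Fintype B] [DecidableEq A]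
    [DecidableEq B] {k n : ℕ} (hB : Fintype.card B = n) (E : Finset (A × B))
    (hdA : ∀ a, 1.0039 * (k : ℝ) ≤ ((E.filter fun p => p.1 = a).card : ℝ))
    (hdB : ∀ b, ((E.filter fun p => p.2 = b).card : ℝ) ≤ 1.0061 * (k : ℝ))
    (hs : ∀ (X : Finset A) (Z : Finset B), Z.card = X.card → 1 ≤ X.card → 10 * X.card < n →
      (E ∩ X ×ˢ Z).card < k / 2 * X.card)
    (X : Finset A) (Z : Finset B) (hX : 10 * X.card < n) :
    k * X.card ≤ (E ∩ X ×ˢ Zᶜ).card + k * Z.card := by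
  rcases le_or_gt X.card Z.card with h | h
  · exact (Nat.mul_le_mul_left k h).trans (Nat.le_add_left _ _)
  have hsplit : (E ∩ X ×ˢ Finset.univ).card = (E ∩ X ×ˢ Z).card + (E ∩ X ×ˢ Zᶜ).card := by
    rw [← Finset.card_union_of_disjoint]
    · congr 1
      ext p
      simp
      tauto
    · rw [Finset.disjoint_left]
      intro p
      simp
      tauto
  have h1 : 1.0039 * (k : ℝ) * X.card ≤ ((E ∩ X ×ˢ Finset.univ).card : ℝ) := by
    have : (E ∩ X ×ˢ Finset.univ).card = ∑ a ∈ X, (E.filter fun p => p.1 = a).card := by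
      rw [Finset.card_eq_sum_card_fiberwise (f := Prod.fst) (t := X)]
      · refine Finset.sum_congr rfl fun a ha => congrArg _ ?_
        ext p
        simp
        rintro rfl -
        exact ha
      · intro p
        simp
    rw [this, Nat.cast_sum, mul_comm, ← nsmul_eq_mul]
    exact Finset.card_nsmul_le_sum _ _ _ fun a _ => hdA a
  have hk0 : (0 : ℝ) ≤ k := k.cast_nonneg
  have hc : ((E ∩ X ×ˢ Finset.univ).card : ℝ)
    = (E ∩ X ×ˢ Z).card + (E ∩ X ×ˢ Zᶜ).card := by exact_mod_cast hsplit
  rcases le_or_gt (2 * Z.card) X.card with h2 | h2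
  · have h3 : ((E ∩ X ×ˢ Z).card : ℝ) ≤ 1.0061 * (k : ℝ) * Z.card := by
      have : (E ∩ X ×ˢ Z).card ≤ ∑ b ∈ Z, (E.filter fun p => p.2 = b).card := by
        rw [Finset.card_eq_sum_card_fiberwise (f := Prod.snd) (t := Z)]
        · refine Finset.sum_le_sum fun b _ => Finset.card_le_card ?_
          exact Finset.filter_subset_filter _ Finset.inter_subset_left
        · intro p
          simp
      rw [mul_comm, ← nsmul_eq_mul]
      refine (Nat.cast_le.2 this).trans ?_
      rw [Nat.cast_sum]
      exact Finset.sum_le_card_nsmul _ _ _ fun b _ => hdB b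
    have h4 : (2 : ℝ) * Z.card ≤ X.card := by exact_mod_cast h2
    have h5 := mul_le_mul_of_nonneg_left h4 hk0
    have h6 : (k : ℝ) * X.card ≤ (E ∩ X ×ˢ Zᶜ).card + k * Z.card := by
      have : 0 ≤ (k : ℝ) * X.card := by positivity
      linarith
    exact_mod_cast h6
  · obtain ⟨Z', hZ, -, hZ'⟩ := Finset.exists_subsuperset_card_eq (Finset.subset_univ Z) h.le
      (by rw [Finset.card_univ]; omega)
    have h3 := hs X Z' hZ' (by omega) hX
    have h4 : (E ∩ X ×ˢ Z).card ≤ (E ∩ X ×ˢ Z').card :=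
      Finset.card_le_card (Finset.inter_subset_inter_left (Finset.product_subset_product_right hZ))
    have h5 : k / 2 * X.card ≤ k * Z.card := by
      calc k / 2 * X.card ≤ k / 2 * (2 * Z.card) := Nat.mul_le_mul_left _ h2.le
        _ = (k / 2 * 2) * Z.card := by ring
        _ ≤ _ := Nat.mul_le_mul_right _ (Nat.div_mul_le_self k 2)
    have h6 : ((E ∩ X ×ˢ Z).card : ℝ) ≤ k * Z.card := by
      exact_mod_cast (h4.trans h3.le).trans h5
    have h7 : (k : ℝ) * X.card ≤ (E ∩ X ×ˢ Zᶜ).card + k * Z.card := by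
      have : 0 ≤ (k : ℝ) * X.card := by positivity
      linarith
    exact_mod_cast h7

/-- The cut condition for a quasirandom, almost regular bipartite graph that is sparse between
small sets of equal size. -/
theorem cut_condition {A B : Type*} [Fintype A] [Fintype B] [DecidableEq A]
    [DecidableEq B] {k n : ℕ} (hn : 0 < n) (hA : Fintype.card A = n) (hB : Fintype.card B = n)
    (E : Finset (A × B))
    (hdA : ∀ a, 1.0039 * (k : ℝ) ≤ ((E.filter fun p => p.1 = a).card : ℝ) ∧
      ((E.filter fun p => p.1 = a).card : ℝ) ≤ 1.0061 * (k : ℝ))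
    (hdB : ∀ b, 1.0039 * (k : ℝ) ≤ ((E.filter fun p => p.2 = b).card : ℝ) ∧
      ((E.filter fun p => p.2 = b).card : ℝ) ≤ 1.0061 * (k : ℝ))
    (hq : ∀ (X : Finset A) (Y : Finset B), n ≤ 10 * X.card → n ≤ 10 * Y.card →
      X.card * Y.card * (k : ℝ) / n ≤ ((E ∩ X ×ˢ Y).card : ℝ))
    (hs : ∀ (X : Finset A) (Z : Finset B), X.card = Z.card → 1 ≤ X.card → 10 * X.card < n →
      (E ∩ X ×ˢ Z).card < k / 2 * X.card)
    (X : Finset A) (Z : Finset B) :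
    k * X.card ≤ (E ∩ X ×ˢ Zᶜ).card + k * Z.card := by
  rcases lt_or_ge (10 * X.card) n with hX | hX
  · exact cut_condition_of_small hB E (fun a => (hdA a).1) (fun b => (hdB b).2)
      (fun X Z h => hs X Z h.symm) X Z hX
  have hXn : X.card + Xᶜ.card = n := by rw [Finset.card_add_card_compl, hA]
  have hZn : Z.card + Zᶜ.card = n := by rw [Finset.card_add_card_compl, hB]
  rcases lt_or_ge (10 * Zᶜ.card) n with hZ | hZ
  · have key (X : Finset A) (Z : Finset B) :
        (E.map (Equiv.prodComm A B).toEmbedding ∩ Z ×ˢ X).card = (E ∩ X ×ˢ Z).card := by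
      rw [← Finset.card_map (Equiv.prodComm A B).toEmbedding (s := E ∩ X ×ˢ Z)]
      congr 1
      ext ⟨b, a⟩
      simp
      tauto
    have key1 (a : A) : ((E.map (Equiv.prodComm A B).toEmbedding).filter fun p => p.2 = a).card
        = (E.filter fun p => p.1 = a).card := by
      rw [Finset.filter_map, Finset.card_map]
      rfl
    have key2 (b : B) : ((E.map (Equiv.prodComm A B).toEmbedding).filter fun p => p.1 = b).card
        = (E.filter fun p => p.2 = b).card := by
      rw [Finset.filter_map, Finset.card_map]
      rfl
    have := cut_condition_of_small (k := k) hA (E.map (Equiv.prodComm A B).toEmbedding)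
      (fun b => by rw [key2]; exact (hdB b).1) (fun a => by rw [key1]; exact (hdA a).2)
      (fun Z X h h1 h2 => by rw [key, ← h]; exact hs X Z h (h ▸ h1) (h ▸ h2)) Zᶜ Xᶜ hZ
    rw [compl_compl, key] at this
    have e1 : k * X.card + k * Xᶜ.card = k * n := by rw [← mul_add, hXn]
    have e2 : k * Z.card + k * Zᶜ.card = k * n := by rw [← mul_add, hZn]
    omega
  · have h1 := hq X Zᶜ hX hZ
    have hn' : (0 : ℝ) < n := by exact_mod_cast hn
    rw [div_le_iff₀ hn'] at h1
    have h2 : (Z.card : ℝ) + Zᶜ.card = n := by exact_mod_cast hZn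
    have h3 : (X.card : ℝ) + Xᶜ.card = n := by exact_mod_cast hXn
    have h4 : 0 ≤ (k : ℝ) * (Xᶜ.card * Z.card) := by positivity
    have h5 : (k : ℝ) * X.card ≤ (E ∩ X ×ˢ Zᶜ).card + k * Z.card := by
      refine le_of_mul_le_mul_right ?_ hn'
      rw [add_mul]
      have e1 : (Zᶜ.card : ℝ) = n - Z.card := by linarith
      have e2 : (Xᶜ.card : ℝ) = n - X.card := by linarith
      rw [e1] at h1
      rw [e2] at h4
      linarith
    exact_mod_cast h5

theorem choose_le_three_mul_div_pow (N : ℕ) {t : ℕ} (ht : 1 ≤ t) :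
    (N.choose t : ℝ) ≤ (3 * N / t) ^ t := by
  have ht' : (0 : ℝ) < t := by exact_mod_cast ht
  have h1 := Real.pow_div_factorial_le_exp t ht'.le t
  rw [← Real.exp_one_pow] at h1
  have h2 : Real.exp 1 ^ t ≤ 3 ^ t :=
    pow_le_pow_left₀ (Real.exp_pos 1).le Real.exp_one_lt_three.le t
  calc (N.choose t : ℝ) ≤ (N : ℝ) ^ t / t.factorial := Nat.choose_le_pow_div t N
    _ = (N / t : ℝ) ^ t * ((t : ℝ) ^ t / t.factorial) := by
        rw [← mul_div_assoc, ← mul_pow, div_mul_cancel₀ _ ht'.ne']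
    _ ≤ (N / t : ℝ) ^ t * 3 ^ t := by gcongr; exact h1.trans h2
    _ = _ := by rw [← mul_pow]; congr 1; ring

/-- The expected number of dense pairs of vertex sets of size `x`. -/
theorem dense_pair_count_le {n k x : ℕ} (hk : 10 ^ 36 ≤ k) {p : ℝ} (hp0 : 0 ≤ p)
    (hp : p ≤ 1.006 * k / n) (hx : 1 ≤ x) (hxn : 10 * x < n) :
    (n.choose x : ℝ) * n.choose x * ((x * x).choose (k / 2 * x) * p ^ (k / 2 * x))
      ≤ (1 / 4) ^ x := by
  have hkh : (k : ℝ) ≤ 2 * (k / 2 : ℕ) + 1 := by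
    have : k ≤ 2 * (k / 2) + 1 := by omega
    exact_mod_cast this
  have hh : 1000 ≤ k / 2 := by omega
  clear hk
  generalize k / 2 = h at *
  have hh' : (1000 : ℝ) ≤ h := by exact_mod_cast hh
  have hx' : (1 : ℝ) ≤ x := by exact_mod_cast hx
  have hxn' : 10 * (x : ℝ) < n := by exact_mod_cast hxn
  have hn' : (0 : ℝ) < n := by linarith
  have hp1 : p ≤ 2.02 * h / n := hp.trans (by gcongr ?_ / _; linarith)
  have h1 : ((x * x).choose (h * x) : ℝ) * p ^ (h * x) ≤ (6.06 * (x / n : ℝ)) ^ (h * x) := by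
    calc ((x * x).choose (h * x) : ℝ) * p ^ (h * x)
        ≤ (3 * (x * x : ℕ) / (h * x : ℕ)) ^ (h * x) * (2.02 * h / n) ^ (h * x) := by
          gcongr
          exact choose_le_three_mul_div_pow _ (Nat.mul_pos (by omega) hx)
      _ = _ := by
          rw [← mul_pow]
          congr 1
          push_cast
          field_simp
          norm_num
  have h2 := choose_le_three_mul_div_pow n hx
  have hu : (x / n : ℝ) ≤ 1 / 10 := by
    rw [div_le_iff₀ hn']
    linarith
  have h3 : (3 * n / x : ℝ) ^ 2 * (6.06 * (x / n)) ^ h ≤ 1 / 4 := by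
    obtain ⟨j, rfl⟩ : ∃ j, h = j + 20 + 2 := ⟨h - 22, by omega⟩
    have e : (3 * n / x : ℝ) ^ 2 * (6.06 * (x / n)) ^ (j + 20 + 2)
        = 18.18 ^ 2 * (6.06 * (x / n)) ^ (j + 20) := by
      rw [pow_add _ (j + 20) 2]
      field_simp
      norm_num
    rw [e]
    have h4 : (6.06 * (x / n : ℝ)) ^ (j + 20) ≤ 0.606 ^ 20 := by
      have h5 : (6.06 * (x / n : ℝ)) ≤ 0.606 := by linarith
      have h6 : (0 : ℝ) ≤ 6.06 * (x / n) := by positivity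
      calc (6.06 * (x / n : ℝ)) ^ (j + 20) ≤ 0.606 ^ (j + 20) := by gcongr
        _ ≤ 0.606 ^ 20 := pow_le_pow_of_le_one (by norm_num) (by norm_num) (by omega)
    calc (18.18 : ℝ) ^ 2 * (6.06 * (x / n)) ^ (j + 20) ≤ 18.18 ^ 2 * 0.606 ^ 20 := by gcongr
      _ ≤ 1 / 4 := by norm_num
  calc (n.choose x : ℝ) * n.choose x * ((x * x).choose (h * x) * p ^ (h * x))
      ≤ (3 * n / x) ^ x * (3 * n / x) ^ x * (6.06 * (x / n : ℝ)) ^ (h * x) := by gcongr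
    _ = ((3 * n / x : ℝ) ^ 2 * (6.06 * (x / n)) ^ h) ^ x := by
        rw [pow_mul, ← mul_pow, ← mul_pow, ← sq]
    _ ≤ _ := by gcongr

/-- A spread distribution has a set in its support that is sparse between small sets. -/
theorem exists_mem_support_sparse {Ω : Type*} [DecidableEq Ω] {n k : ℕ} (hk : 10 ^ 36 ≤ k) {p : ℝ}
    (hp0 : 0 ≤ p) (hp : p ≤ 1.006 * k / n) (φ : Fin n × Fin n → Ω) (μ : PMF (Finset Ω))
    (hμ : ∀ T : Finset (Fin n × Fin n),
      μ.toOuterMeasure {S | T.image φ ⊆ S} ≤ ENNReal.ofReal (p ^ T.card)) :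
    ∃ S, μ S ≠ 0 ∧ ∀ X Z : Finset (Fin n), X.card = Z.card → 1 ≤ X.card → 10 * X.card < n →
      ((Finset.univ.filter fun q => φ q ∈ S) ∩ X ×ˢ Z).card < k / 2 * X.card := by
  by_contra! hcon
  let I := (Finset.Ico 1 n).filter fun x => 10 * x < n
  let P (x : ℕ) := Finset.powersetCard x (Finset.univ : Finset (Fin n))
  have hcover : μ.support ⊆ ⋃ x ∈ I, ⋃ q ∈ P x ×ˢ P x,
      ⋃ T ∈ Finset.powersetCard (k / 2 * x) (q.1 ×ˢ q.2), {S | T.image φ ⊆ S} := by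
    intro S hS
    obtain ⟨X, Z, hXZ, hX1, hX, hc⟩ := hcon S hS
    obtain ⟨T, hT, hTc⟩ := Finset.exists_subset_card_eq hc
    simp only [Set.mem_iUnion]
    refine ⟨X.card, ?_, (X, Z), ?_, T, ?_, ?_⟩
    · simp only [I, Finset.mem_filter, Finset.mem_Ico]
      omega
    · simp [P, hXZ]
    · exact Finset.mem_powersetCard.2 ⟨hT.trans Finset.inter_subset_right, hTc⟩
    · intro w hw
      obtain ⟨q, hq, rfl⟩ := Finset.mem_image.1 hw
      simpa using (Finset.mem_inter.1 (hT hq)).1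
  have h1 := (PMF.toOuterMeasure_apply_eq_one_iff μ _).2 hcover
  have hterm (x : ℕ) (hx : x ∈ I) : μ.toOuterMeasure (⋃ q ∈ P x ×ˢ P x,
      ⋃ T ∈ Finset.powersetCard (k / 2 * x) (q.1 ×ˢ q.2), {S | T.image φ ⊆ S})
      ≤ ENNReal.ofReal ((1 / 4) ^ x) := by
    simp only [I, Finset.mem_filter, Finset.mem_Ico] at hx
    refine (MeasureTheory.measure_biUnion_finset_le _ _).trans ?_
    have hq : ∀ q ∈ P x ×ˢ P x,
        μ.toOuterMeasure (⋃ T ∈ Finset.powersetCard (k / 2 * x) (q.1 ×ˢ q.2),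
          {S | T.image φ ⊆ S})
        ≤ ENNReal.ofReal ((x * x).choose (k / 2 * x) * p ^ (k / 2 * x)) := by
      intro q hq
      simp only [P, Finset.mem_product, Finset.mem_powersetCard, Finset.subset_univ,
        true_and] at hq
      refine (MeasureTheory.measure_biUnion_finset_le _ _).trans ?_
      refine (Finset.sum_le_card_nsmul _ _ (ENNReal.ofReal (p ^ (k / 2 * x))) ?_).trans_eq ?_
      · intro T hT
        rw [← (Finset.mem_powersetCard.1 hT).2]
        exact hμ T
      · rw [Finset.card_powersetCard, Finset.card_product, hq.1, hq.2, nsmul_eq_mul,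
          ENNReal.ofReal_mul (Nat.cast_nonneg _), ENNReal.ofReal_natCast]
    refine (Finset.sum_le_card_nsmul _ _ _ hq).trans ?_
    rw [nsmul_eq_mul, ← ENNReal.ofReal_natCast, ← ENNReal.ofReal_mul (Nat.cast_nonneg _)]
    refine ENNReal.ofReal_le_ofReal (le_trans (le_of_eq ?_)
      (dense_pair_count_le hk hp0 hp hx.1.1 hx.2))
    simp [P]
  have h2 : (1 : ENNReal) ≤ ENNReal.ofReal (1 / 3) := by
    rw [← h1]
    refine (MeasureTheory.measure_biUnion_finset_le _ _).trans ?_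
    refine (Finset.sum_le_sum hterm).trans ?_
    rw [← ENNReal.ofReal_sum_of_nonneg fun _ _ => by positivity]
    refine ENNReal.ofReal_le_ofReal ?_
    calc ∑ x ∈ I, (1 / 4 : ℝ) ^ x ≤ ∑ x ∈ Finset.Ico 1 n, (1 / 4 : ℝ) ^ x :=
          Finset.sum_le_sum_of_subset_of_nonneg (Finset.filter_subset _ _)
            fun _ _ _ => by positivity
      _ ≤ (1 / 4) ^ 1 / (1 - 1 / 4) :=
          geom_sum_Ico_le_of_lt_one (by norm_num) (by norm_num)
      _ = 1 / 3 := by norm_num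
  rw [ENNReal.one_le_ofReal] at h2
  norm_num at h2

/-- The embedding of `Fin n × Fin n` onto the grid `[n]²`. -/
def gridPoint (n : ℕ) (q : Fin n × Fin n) : ℝ × ℝ :=
  (((q.1 : ℕ) : ℝ) + 1, ((q.2 : ℕ) : ℝ) + 1)

theorem gridPoint_injective (n : ℕ) : Function.Injective (gridPoint n) := by
  rintro ⟨a, b⟩ ⟨a', b'⟩ h
  simp only [gridPoint, Prod.mk.injEq, add_left_inj, Nat.cast_inj] at h
  exact Prod.ext (Fin.ext h.1) (Fin.ext h.2)

theorem range_gridPoint (n : ℕ) : Set.range (gridPoint n) = grid2 n := by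
  ext p
  constructor
  · rintro ⟨⟨a, b⟩, rfl⟩
    refine ⟨a + 1, b + 1, ?_, ?_, ?_, ?_, ?_⟩
    any_goals omega
    simp [gridPoint]
  · rintro ⟨a, b, ha, ha', hb, hb', rfl⟩
    lift a to ℕ using by omega
    lift b to ℕ using by omega
    refine ⟨(⟨a - 1, by omega⟩, ⟨b - 1, by omega⟩), ?_⟩
    have ha1 : 1 ≤ a := by omega
    have hb1 : 1 ≤ b := by omega
    simp [gridPoint, Nat.cast_sub ha1, Nat.cast_sub hb1]

open Classical in
/-- The points of `Fin n × Fin n` whose image in the grid lies in `S`. -/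
def gridEdges (n : ℕ) (S : Set (ℝ × ℝ)) : Finset (Fin n × Fin n) :=
  Finset.univ.filter fun q => gridPoint n q ∈ S

theorem mem_gridEdges {n : ℕ} {S : Set (ℝ × ℝ)} {q : Fin n × Fin n} :
    q ∈ gridEdges n S ↔ gridPoint n q ∈ S := by
  simp [gridEdges]

theorem ncard_inter_eq {n : ℕ} {S : Set (ℝ × ℝ)} (hS : S ⊆ grid2 n) (R : Set (ℝ × ℝ))
    (F : Finset (Fin n × Fin n)) (hF : ∀ q, q ∈ F ↔ gridPoint n q ∈ S ∧ gridPoint n q ∈ R) :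
    (S ∩ R).ncard = F.card := by
  have : S ∩ R = gridPoint n '' (F : Set (Fin n × Fin n)) := by
    ext p
    constructor
    · rintro ⟨hp, hR⟩
      obtain ⟨q, rfl⟩ := (range_gridPoint n).symm ▸ hS hp
      exact ⟨q, (hF q).2 ⟨hp, hR⟩, rfl⟩
    · rintro ⟨q, hq, rfl⟩
      exact (hF q).1 hq
  rw [this, Set.ncard_image_of_injective _ (gridPoint_injective n), Set.ncard_coe_finset]

theorem exists_horizontal_line (c : ℝ) :
    ∃ L : AffineSubspace ℝ (ℝ × ℝ), IsLine L ∧ (L : Set (ℝ × ℝ)) = {p | p.2 = c} := by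
  refine ⟨AffineSubspace.mk' (0, c) (ℝ ∙ ((1, 0) : ℝ × ℝ)), ?_, ?_⟩
  · rw [IsLine, AffineSubspace.direction_mk']
    exact finrank_span_singleton (by simp)
  · ext ⟨x, y⟩
    simp [AffineSubspace.mem_mk', Submodule.mem_span_singleton, sub_eq_zero, eq_comm]

theorem exists_vertical_line (c : ℝ) :
    ∃ L : AffineSubspace ℝ (ℝ × ℝ), IsLine L ∧ (L : Set (ℝ × ℝ)) = {p | p.1 = c} := by
  refine ⟨AffineSubspace.mk' (c, 0) (ℝ ∙ ((0, 1) : ℝ × ℝ)), ?_, ?_⟩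
  · rw [IsLine, AffineSubspace.direction_mk']
    exact finrank_span_singleton (by simp)
  · ext ⟨x, y⟩
    simp [AffineSubspace.mem_mk', Submodule.mem_span_singleton, sub_eq_zero, eq_comm]

theorem gridPoint_fst_eq {n : ℕ} (q : Fin n × Fin n) (a : Fin n) :
    (gridPoint n q).1 = ((a : ℕ) : ℝ) + 1 ↔ q.1 = a := by
  simp [gridPoint, Fin.ext_iff]

theorem gridPoint_snd_eq {n : ℕ} (q : Fin n × Fin n) (b : Fin n) :
    (gridPoint n q).2 = ((b : ℕ) : ℝ) + 1 ↔ q.2 = b := by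
  simp [gridPoint, Fin.ext_iff]

theorem error_bounds {k : ℕ} (hk : 10 ^ 36 ≤ k) :
    1 < (1 + 0.005) * (k : ℝ) ∧ ((1 + 0.005) * (k : ℝ)) ^ (-(1 : ℝ) / 12) ≤ 0.001 := by
  have hk' : (10 ^ 36 : ℝ) ≤ k := by exact_mod_cast hk
  have hm : (10 ^ 36 : ℝ) ≤ (1 + 0.005) * k := by linarith
  refine ⟨by linarith, ?_⟩
  refine (Real.rpow_le_rpow_of_nonpos (by norm_num) hm (by norm_num)).trans_eq ?_
  rw [← Real.rpow_natCast, ← Real.rpow_mul (by norm_num)]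
  rw [show ((36 : ℕ) : ℝ) * (-1 / 12) = ((-3 : ℤ) : ℝ) by norm_num, Real.rpow_intCast]
  norm_num

/-- A full grid line meets a nice set in roughly the expected number of points. -/
theorem IsNice.card_line_bounds {n k : ℕ} (hk : 10 ^ 36 ≤ k) (hkn : k ≤ n) {S : Set (ℝ × ℝ)}
    (hS : IsNice n ((1 + 0.005) * (k : ℝ)) S) {L : AffineSubspace ℝ (ℝ × ℝ)} (hL : IsLine L)
    (hc : (grid2 n ∩ (L : Set (ℝ × ℝ))).ncard = n) :
    1.0039 * (k : ℝ) ≤ ((S ∩ L).ncard : ℝ) ∧ ((S ∩ L).ncard : ℝ) ≤ 1.0061 * (k : ℝ) := by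
  obtain ⟨hm, hδ⟩ := error_bounds hk
  have hn : (0 : ℝ) < n := by
    have : 0 < n := by omega
    exact_mod_cast this
  have hw : lineWeight n L = 1 := by
    rw [lineWeight, hc, div_self hn.ne']
  have h := hS.2.1 L ⟨hL, by rw [hc]; omega⟩
    (by rw [hw]; exact Real.rpow_lt_one_of_one_lt_of_neg hm (by norm_num)) hw.le
  rw [hw, mul_one, mul_one] at h
  have hk0 : (0 : ℝ) < k := by linarith
  have h1 := mul_le_mul_of_nonneg_right hδ (zero_le_one.trans hm.le)
  constructor
  · refine le_trans ?_ h.1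
    linarith
  · refine h.2.trans ?_
    linarith

theorem IsNice.card_row_bounds {n k : ℕ} (hk : 10 ^ 36 ≤ k) (hkn : k ≤ n) {S : Set (ℝ × ℝ)}
    (hS : IsNice n ((1 + 0.005) * (k : ℝ)) S) (b : Fin n) :
    1.0039 * (k : ℝ) ≤ (((gridEdges n S).filter fun p => p.2 = b).card : ℝ) ∧
      (((gridEdges n S).filter fun p => p.2 = b).card : ℝ) ≤ 1.0061 * (k : ℝ) := by
  obtain ⟨L, hL, hLs⟩ := exists_horizontal_line (((b : ℕ) : ℝ) + 1)
  have hg : (grid2 n ∩ (L : Set (ℝ × ℝ))).ncard = n := by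
    rw [ncard_inter_eq subset_rfl _ (Finset.univ ×ˢ {b})]
    · simp
    · intro q
      have := range_gridPoint n ▸ Set.mem_range_self q
      rw [Finset.mem_product, Finset.mem_singleton, hLs, Set.mem_ofPred_eq, gridPoint_snd_eq]
      simp [this]
  have := hS.card_line_bounds hk hkn hL hg
  rwa [ncard_inter_eq hS.1 _ ((gridEdges n S).filter fun p => p.2 = b)] at this
  intro q
  simp [hLs, gridPoint_snd_eq, mem_gridEdges]

theorem IsNice.card_column_bounds {n k : ℕ} (hk : 10 ^ 36 ≤ k) (hkn : k ≤ n)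
    {S : Set (ℝ × ℝ)} (hS : IsNice n ((1 + 0.005) * (k : ℝ)) S) (a : Fin n) :
    1.0039 * (k : ℝ) ≤ (((gridEdges n S).filter fun p => p.1 = a).card : ℝ) ∧
      (((gridEdges n S).filter fun p => p.1 = a).card : ℝ) ≤ 1.0061 * (k : ℝ) := by
  obtain ⟨L, hL, hLs⟩ := exists_vertical_line (((a : ℕ) : ℝ) + 1)
  have hg : (grid2 n ∩ (L : Set (ℝ × ℝ))).ncard = n := by
    rw [ncard_inter_eq subset_rfl _ ({a} ×ˢ Finset.univ)]
    · simp
    · intro q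
      have := range_gridPoint n ▸ Set.mem_range_self q
      rw [Finset.mem_product, Finset.mem_singleton, hLs, Set.mem_ofPred_eq, gridPoint_fst_eq]
      simp [this]
  have := hS.card_line_bounds hk hkn hL hg
  rwa [ncard_inter_eq hS.1 _ ((gridEdges n S).filter fun p => p.1 = a)] at this
  intro q
  simp [hLs, gridPoint_fst_eq, mem_gridEdges]

theorem IsNice.le_card_inter_product {n k : ℕ} (hk : 10 ^ 36 ≤ k) {S : Set (ℝ × ℝ)}
    (hS : IsNice n ((1 + 0.005) * (k : ℝ)) S) (X Y : Finset (Fin n))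
    (hX : n ≤ 10 * X.card) (hY : n ≤ 10 * Y.card) :
    X.card * Y.card * (k : ℝ) / n ≤ ((gridEdges n S ∩ X ×ˢ Y).card : ℝ) := by
  obtain ⟨hm, hδ⟩ := error_bounds hk
  let ψ : Fin n ↪ ℤ := ⟨fun i => ((i : ℕ) : ℤ) + 1, fun i j h => Fin.ext (by simpa using h)⟩
  have ψ_apply (i : Fin n) : ψ i = ((i : ℕ) : ℤ) + 1 := rfl
  have hψ (W : Finset (Fin n)) : ((W.map ψ : Finset ℤ) : Set ℤ) ⊆ Set.Icc (1 : ℤ) (n : ℤ) := by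
    intro z hz
    obtain ⟨i, -, rfl⟩ := Finset.mem_map.1 (Finset.mem_coe.1 hz)
    rw [ψ_apply, Set.mem_Icc]
    omega
  have hX' : (n : ℝ) ≤ 10 * X.card := by exact_mod_cast hX
  have hY' : (n : ℝ) ≤ 10 * Y.card := by exact_mod_cast hY
  have h := (hS.2.2.2.2 (X.map ψ) (Y.map ψ) (hψ X) (hψ Y)
    (by rw [Finset.card_map]; linarith) (by rw [Finset.card_map]; linarith)).1
  rw [ncard_inter_eq hS.1 _ (gridEdges n S ∩ X ×ˢ Y), Finset.card_map, Finset.card_map] at h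
  · refine le_trans ?_ h
    have h1 : 1 ≤ (1 - ((1 + 0.005) * (k : ℝ)) ^ (-(1 : ℝ) / 12)) * (1 + 0.005) := by linarith
    have h2 : 0 ≤ X.card * Y.card * (k : ℝ) / n := by positivity
    calc X.card * Y.card * (k : ℝ) / n = 1 * (X.card * Y.card * (k : ℝ) / n) := (one_mul _).symm
      _ ≤ _ := mul_le_mul_of_nonneg_right h1 h2
      _ = _ := by ring
  · intro q
    have hq : gridPoint n q ∈ gridRect (X.map ψ) (Y.map ψ) ↔ q.1 ∈ X ∧ q.2 ∈ Y := by
      constructor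
      · rintro ⟨a, ha, b, hb, h⟩
        obtain ⟨i, hi, rfl⟩ := Finset.mem_map.1 ha
        obtain ⟨j, hj, rfl⟩ := Finset.mem_map.1 hb
        have h1 : q.1 = i := (gridPoint_fst_eq q i).1 (by rw [h]; simp [ψ_apply])
        have h2 : q.2 = j := (gridPoint_snd_eq q j).1 (by rw [h]; simp [ψ_apply])
        exact ⟨h1 ▸ hi, h2 ▸ hj⟩
      · rintro ⟨h1, h2⟩
        refine ⟨_, Finset.mem_map_of_mem ψ h1, _, Finset.mem_map_of_mem ψ h2, ?_⟩
        simp [ψ_apply, gridPoint]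
    rw [hq, Finset.mem_inter, Finset.mem_product, mem_gridEdges]

/-- regularisation. Let `10^36 ≤ k ≤ n` and `ε = 0.005`. If `μ` is a
`(((1+ε)k+1)/n)`-spread distribution supported on `(1+ε)k`-nice sets, then with positive
probability a sample `S` from `μ` has a subset `S'` containing exactly `k` points on each
horizontal and each vertical line through the grid. -/
theorem regularisation (n k : ℕ) (hk : 10 ^ 36 ≤ k) (hkn : k ≤ n)
    (μ : PMF (Finset (ℝ × ℝ)))
    (hspread : IsSpread n (((1 + 0.005) * (k : ℝ) + 1) / n) μ)
    (hsupp : SupportedOnNice n ((1 + 0.005) * (k : ℝ)) μ) :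
    0 < μ.toOuterMeasure {S : Finset (ℝ × ℝ) |
      ∃ S' : Set (ℝ × ℝ), S' ⊆ ↑S ∧
        (∀ c : ℤ, 1 ≤ c → c ≤ (n : ℤ) →
          (S' ∩ {p : ℝ × ℝ | p.2 = (c : ℝ)}).ncard = k) ∧
        (∀ c : ℤ, 1 ≤ c → c ≤ (n : ℤ) →
          (S' ∩ {p : ℝ × ℝ | p.1 = (c : ℝ)}).ncard = k)} := by
  classical
  have hk1 : (10 ^ 36 : ℝ) ≤ k := by exact_mod_cast hk
  have hn : 0 < n := by omega
  have hn' : (0 : ℝ) < n := by exact_mod_cast hn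
  obtain ⟨S, hS, hsparse⟩ := exists_mem_support_sparse hk (n := n)
    (p := ((1 + 0.005) * (k : ℝ) + 1) / n) (by positivity)
    (by gcongr; linarith) (gridPoint n) μ (by
      intro T
      have h := hspread (T.image (gridPoint n)) (by
        rw [← range_gridPoint, Finset.coe_image]
        exact Set.image_subset_range _ _)
      rw [Finset.card_image_of_injective _ (gridPoint_injective n)] at h
      exact (ENNReal.le_ofReal_iff_toReal_le
        (ne_top_of_le_ne_top ENNReal.one_ne_top ((MeasureTheory.measure_mono (subset_univ _)).trans_eq
          ((μ.toOuterMeasure_apply_eq_one_iff _).2 (subset_univ _))))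
        (by positivity)).2 h)
  have hnice := hsupp S hS
  have hsparse' (X Z : Finset (Fin n)) (h : X.card = Z.card) (h1 : 1 ≤ X.card)
      (h2 : 10 * X.card < n) : (gridEdges n S ∩ X ×ˢ Z).card < k / 2 * X.card := by
    convert hsparse X Z h h1 h2 using 3
    ext q
    simp [mem_gridEdges]
  obtain ⟨F, hF, hFa, hFb⟩ := exists_regular_subset k rfl (gridEdges n S)
    (cut_condition hn (Fintype.card_fin n) (Fintype.card_fin n) (gridEdges n S)
      (hnice.card_column_bounds hk hkn) (hnice.card_row_bounds hk hkn)
      (hnice.le_card_inter_product hk) hsparse')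
  have hFS : gridPoint n '' (F : Set (Fin n × Fin n)) ⊆ S := by
    rintro _ ⟨q, hq, rfl⟩
    exact mem_gridEdges.1 (hF hq)
  have hmem (q : Fin n × Fin n) : gridPoint n q ∈ gridPoint n '' (F : Set (Fin n × Fin n))
      ↔ q ∈ F := by
    rw [(gridPoint_injective n).mem_set_image, Finset.mem_coe]
  have hcast (c : ℤ) (hc : 1 ≤ c) (hcn : c ≤ n) : ∃ i : Fin n, (c : ℝ) = ((i : ℕ) : ℝ) + 1 := by
    lift c to ℕ using by omega
    refine ⟨⟨c - 1, by omega⟩, ?_⟩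
    simp [Nat.cast_sub (show 1 ≤ c by omega)]
  rw [pos_iff_ne_zero, Ne, PMF.toOuterMeasure_apply_eq_zero_iff, Set.not_disjoint_iff]
  refine ⟨S, hS, gridPoint n '' (F : Set (Fin n × Fin n)), hFS, ?_, ?_⟩
  · intro c hc hcn
    obtain ⟨b, hb⟩ := hcast c hc hcn
    rw [ncard_inter_eq (hFS.trans hnice.1) _ (F.filter fun p => p.2 = b), hFb]
    intro q
    rw [hmem, Finset.mem_filter, Set.mem_ofPred_eq, hb, gridPoint_snd_eq]
  · intro c hc hcn
    obtain ⟨a, ha⟩ := hcast c hc hcn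
    rw [ncard_inter_eq (hFS.trans hnice.1) _ (F.filter fun p => p.1 = a), hFa]
    intro q
    rw [hmem, Finset.mem_filter, Set.mem_ofPred_eq, ha, gridPoint_fst_eq]
end
end

section
/- Let ε = 0.005, let k be a positive real, and let G be a bipartite graph with parts A₀ and B₀ such that every vertex of G has degree in the interval [(1−ε/4)·(1+ε)·k, (1+ε/4)·(1+ε)·k]. Then for all subsets A ⊆ A₀ and B ⊆ B₀ with |A| > 2|B|, the number of edges of G between A and B₀ ∖ B satisfies e_G(A, B₀ ∖ B) ≥ k·(|A| − |B|). -/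
open Finset

/-- The elements that `f` sends into `S` are counted fibre by fibre. -/
theorem card_filter_mem_eq_sum_card_fiber {ι γ : Type*} [DecidableEq γ]
    (E : Finset ι) (f : ι → γ) (S : Finset γ) :
    (E.filter fun e => f e ∈ S).card = ∑ c ∈ S, (E.filter fun e => f e = c).card := by
  rw [card_eq_sum_card_fiberwise (s := E.filter fun e => f e ∈ S) (f := f) (t := S)
    (fun e he => (mem_filter.1 he).2)]
  refine sum_congr rfl fun c hc => ?_
  rw [filter_filter]
  congr 1
  refine filter_congr fun e _ => ?_
  constructor
  · exact fun h => h.2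
  · exact fun h => ⟨h ▸ hc, h⟩

/-- type 1 pairs. Let `ε = 0.005`, `k > 0`, and let `G` be a bipartite graph
with parts `A₀` and `B₀` (modelled by its edge set `E ⊆ A₀ × B₀`) in which every vertex has
degree in `[(1-ε/4)(1+ε)k, (1+ε/4)(1+ε)k]`. Then for all `A ⊆ A₀`, `B ⊆ B₀` with `|A| > 2|B|`,
we have `e_G(A, B₀ \ B) ≥ k (|A| - |B|)`. -/
theorem type_one_pairs {α β : Type*} [Fintype α] [Fintype β] [DecidableEq α] [DecidableEq β]
    (E : Finset (α × β)) (k : ℝ) (hk : 0 < k)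
    (hdegA : ∀ a : α,
      (1 - 0.005/4) * (1 + 0.005) * k ≤ ((E.filter fun e => e.1 = a).card : ℝ) ∧
      ((E.filter fun e => e.1 = a).card : ℝ) ≤ (1 + 0.005/4) * (1 + 0.005) * k)
    (hdegB : ∀ b : β,
      (1 - 0.005/4) * (1 + 0.005) * k ≤ ((E.filter fun e => e.2 = b).card : ℝ) ∧
      ((E.filter fun e => e.2 = b).card : ℝ) ≤ (1 + 0.005/4) * (1 + 0.005) * k)
    (A : Finset α) (B : Finset β) (hAB : 2 * B.card < A.card) :
    k * ((A.card : ℝ) - (B.card : ℝ)) ≤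
      ((E.filter fun e => e.1 ∈ A ∧ e.2 ∉ B).card : ℝ) := by
  have hA : (A.card : ℝ) * ((1 - 0.005/4) * (1 + 0.005) * k) ≤
      ((E.filter fun e => e.1 ∈ A).card : ℝ) := by
    rw [card_filter_mem_eq_sum_card_fiber E Prod.fst A, Nat.cast_sum, ← nsmul_eq_mul]
    exact card_nsmul_le_sum _ _ _ fun a _ => (hdegA a).1
  have hB : ((E.filter fun e => e.2 ∈ B).card : ℝ) ≤
      (B.card : ℝ) * ((1 + 0.005/4) * (1 + 0.005) * k) := by
    rw [card_filter_mem_eq_sum_card_fiber E Prod.snd B, Nat.cast_sum, ← nsmul_eq_mul]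
    exact sum_le_card_nsmul _ _ _ fun b _ => (hdegB b).2
  have hsplit : (E.filter fun e => e.1 ∈ A).card ≤
      (E.filter fun e => e.1 ∈ A ∧ e.2 ∉ B).card + (E.filter fun e => e.2 ∈ B).card := by
    refine (card_le_card fun e he => ?_).trans (card_union_le _ _)
    simp only [mem_union, mem_filter] at he ⊢
    tauto
  have hsplit' : ((E.filter fun e => e.1 ∈ A).card : ℝ) ≤
      ((E.filter fun e => e.1 ∈ A ∧ e.2 ∉ B).card : ℝ) +
        ((E.filter fun e => e.2 ∈ B).card : ℝ) := by
    exact_mod_cast hsplit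
  have hcard : 2 * (B.card : ℝ) ≤ (A.card : ℝ) := by exact_mod_cast hAB.le
  have hk' : 2 * (B.card : ℝ) * k ≤ (A.card : ℝ) * k :=
    mul_le_mul_of_nonneg_right hcard hk.le
  have hBk : 0 ≤ (B.card : ℝ) * k := by positivity
  linarith
end

section
/- Let ε = 0.005, let n be a positive integer, let k be a positive real, and let G be a bipartite graph with parts A₀ and B₀ each of size n such that for all subsets I ⊆ A₀ and J ⊆ B₀ with |I| ≥ n/10 and |J| ≥ n/10 one has e_G(I, J) ≥ (1−ε/4)·(1+ε)·k·|I|·|J|/n. Then for all subsets A ⊆ A₀ and B ⊆ B₀ with |A| ≥ n/10 and |B| ≤ n/2, the number of edges of G between A and B₀ ∖ B satisfies e_G(A, B₀ ∖ B) ≥ k·(|A| − |B|). -/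
open Finset

/-- type 2 pairs. Let `ε = 0.005`, let `G` be a bipartite graph with parts
`A₀`, `B₀` of size `n` (modelled by its edge set `E ⊆ A₀ × B₀`) such that
`e_G(I, J) ≥ (1-ε/4)(1+ε)k|I||J|/n` for all `I ⊆ A₀`, `J ⊆ B₀` with `|I|, |J| ≥ n/10`.
Then for all `A ⊆ A₀`, `B ⊆ B₀` with `|A| ≥ n/10` and `|B| ≤ n/2`, we have
`e_G(A, B₀ \ B) ≥ k (|A| - |B|)`. -/
theorem type_two_pairs {α β : Type*} [Fintype α] [Fintype β] [DecidableEq α] [DecidableEq β]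
    (n : ℕ) (hn : 0 < n) (hA₀ : Fintype.card α = n) (hB₀ : Fintype.card β = n)
    (E : Finset (α × β)) (k : ℝ) (hk : 0 < k)
    (hquasi : ∀ (I : Finset α) (J : Finset β),
      (n : ℝ)/10 ≤ (I.card : ℝ) → (n : ℝ)/10 ≤ (J.card : ℝ) →
      (1 - 0.005/4) * (1 + 0.005) * k * (I.card : ℝ) * (J.card : ℝ) / (n : ℝ) ≤
        ((E.filter fun e => e.1 ∈ I ∧ e.2 ∈ J).card : ℝ))
    (A : Finset α) (B : Finset β)
    (hA : (n : ℝ)/10 ≤ (A.card : ℝ)) (hB : (B.card : ℝ) ≤ (n : ℝ)/2) :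
    k * ((A.card : ℝ) - (B.card : ℝ)) ≤
      ((E.filter fun e => e.1 ∈ A ∧ e.2 ∉ B).card : ℝ) := by
  have hn' : (0 : ℝ) < n := by exact_mod_cast hn
  have hcompl : ((Bᶜ).card : ℝ) = n - B.card := by
    rw [card_compl, Nat.cast_sub (card_le_univ B), hB₀]
  have hAn : (A.card : ℝ) ≤ n := by
    exact_mod_cast hA₀ ▸ card_le_univ A
  have h := hquasi A Bᶜ hA (by rw [hcompl]; linarith)
  simp only [mem_compl, hcompl] at h
  refine le_trans ?_ h
  rw [le_div_iff₀ hn']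
  have hb : (0 : ℝ) ≤ B.card := Nat.cast_nonneg _
  have ha : (0 : ℝ) ≤ A.card := Nat.cast_nonneg _
  have hprod : 0 ≤ k * A.card * (n - B.card) :=
    mul_nonneg (mul_nonneg hk.le ha) (by linarith)
  have hgap : 0 ≤ k * (B.card * (n - A.card)) :=
    mul_nonneg hk.le (mul_nonneg hb (by linarith))
  linarith
end

section
/- Let n, d, t be integers with 1 ≤ t ≤ d−1, and let 𝓗_{n,d,t} be the hypergraph on vertex set [n]^d whose edges are the sets F ⊆ [n]^d of the form F = F' ∩ [n]^d for some t-dimensional affine subspace F' of ℝ^d. Then there exists a constant C = C(d) depending only on d such that 𝓗_{n,d,t} has polynomial tails with parameters N = n^t and C; that is, every edge has at most n^t vertices, and for every x ∈ [n]^d and α ∈ (0,1], the number of edges F with x ∈ F and |F|/n^t ≥ α is at most C·α^{−C}. -/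
open Set

noncomputable section

/-- The grid `[n]^d = {1,…,n}^d` regarded as a subset of `ℝ^d`. -/
def gridD (n d : ℕ) : Set (Fin d → ℝ) :=
  {x | ∀ i, ∃ a : ℤ, 1 ≤ a ∧ a ≤ (n : ℤ) ∧ x i = (a : ℝ)}

/-- A `t`-dimensional affine subspace of `ℝ^d`. -/
def IsAffineOfDim (d t : ℕ) (F : AffineSubspace ℝ (Fin d → ℝ)) : Prop :=
  Module.finrank ℝ F.direction = t

/-- An axis-aligned `t`-dimensional affine subspace of `ℝ^d`: one of the form
`{x : x i = c i for all i ∈ I}` for an index set `I` of size `d - t`. -/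
def IsAxisAligned (d t : ℕ) (F : AffineSubspace ℝ (Fin d → ℝ)) : Prop :=
  ∃ (I : Finset (Fin d)) (c : Fin d → ℝ), I.card = d - t ∧
    (F : Set (Fin d → ℝ)) = {x | ∀ i ∈ I, x i = c i}

/-- A spanning family contains a basis with respect to which every member has coordinates of
absolute value at most one. -/
lemma exists_basis_coord_abs_le_one {V ι : Type*} [AddCommGroup V] [Module ℝ V]
    [FiniteDimensional ℝ V] [Finite ι] (v : ι → V) (hv : Submodule.span ℝ (range v) = ⊤) :
    ∃ (f : Fin (Module.finrank ℝ V) → ι) (a : ι → Fin (Module.finrank ℝ V) → ℝ),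
      (∀ j i, |a j i| ≤ 1) ∧ ∀ j, v j = ∑ i, a j i • v (f i) := by
  classical
  let e := Module.finBasis ℝ V
  obtain ⟨f₀, hf₀⟩ : ∃ f₀ : Fin (Module.finrank ℝ V) → ι, e.det (v ∘ f₀) ≠ 0 := by
    have h := Submodule.exists_fun_fin_finrank_span_eq ℝ (range v)
    rw [hv, finrank_top] at h
    obtain ⟨g, hg, hspan, hli⟩ := h
    choose f₀ hf₀ using hg
    refine ⟨f₀, ?_⟩
    have : v ∘ f₀ = g := funext hf₀
    rw [this]
    exact ((Module.Basis.is_basis_iff_det e).1 ⟨hli, hspan⟩).ne_zero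
  have : Nonempty (Fin (Module.finrank ℝ V) → ι) := ⟨f₀⟩
  obtain ⟨f, hf⟩ := Finite.exists_max fun f : Fin (Module.finrank ℝ V) → ι ↦ |e.det (v ∘ f)|
  have hpos : 0 < |e.det (v ∘ f)| := (abs_pos.2 hf₀).trans_le (hf f₀)
  obtain ⟨hli, hspan⟩ := (Module.Basis.is_basis_iff_det e).2 (abs_pos.1 hpos).isUnit
  let b := Module.Basis.mk hli hspan.ge
  have hb : ⇑b = v ∘ f := Module.Basis.coe_mk _ _
  refine ⟨f, fun j i ↦ b.repr (v j) i, fun j i ↦ ?_, fun j ↦ ?_⟩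
  · have hup : Function.update (v ∘ f) i (v j) = v ∘ Function.update f i j := by
      rw [Function.comp_update]
    have hdet : e.det (v ∘ Function.update f i j) = e.det (v ∘ f) * b.repr (v j) i := by
      rw [← hup, e.det.eq_smul_basis_det b, AlternatingMap.smul_apply, AlternatingMap.smul_apply,
        ← hb, b.det_self, smul_eq_mul, smul_eq_mul, mul_one]
      congr 1
      conv_lhs => rw [← b.sum_repr (v j)]
      rw [AlternatingMap.map_update_sum, Finset.sum_eq_single i]
      · simp [AlternatingMap.map_update_smul, b.det_self]
      · intro k _ hk
        rw [AlternatingMap.map_update_smul, AlternatingMap.map_update_self _ _ hk.symm, smul_zero]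
      · simp
    have := hf (Function.update f i j)
    rw [hdet, abs_mul] at this
    exact (mul_le_iff_le_one_right hpos).1 this
  · conv_lhs => rw [← b.sum_repr (v j), hb]
    rfl

/-- A subspace of `ℝ^d` of dimension `s` is the graph, over `s` of the coordinates, of a linear map
whose matrix has entries of absolute value at most one. -/
lemma Submodule.exists_coord_graph {d : ℕ} (U : Submodule ℝ (Fin d → ℝ)) :
    ∃ (f : Fin (Module.finrank ℝ U) → Fin d) (a : Fin d → Fin (Module.finrank ℝ U) → ℝ),
      (∀ j i, |a j i| ≤ 1) ∧ ∀ w ∈ U, ∀ j, w j = ∑ i, a j i * w (f i) := by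
  have h := exists_basis_coord_abs_le_one
    (fun j : Fin d ↦ (LinearMap.proj j).comp U.subtype : Fin d → Module.Dual ℝ U) <| by
    rw [eq_top_iff]
    intro φ _
    obtain ⟨ψ, hψ⟩ := LinearMap.exists_extend φ
    have : φ = ∑ j, ψ (Pi.single j 1) • (LinearMap.proj j).comp U.subtype := by
      ext w
      rw [← hψ]
      simp only [LinearMap.comp_apply, LinearMap.sum_apply, LinearMap.smul_apply,
        LinearMap.proj_apply, smul_eq_mul]
      conv_lhs => rw [pi_eq_sum_univ' (U.subtype w)]
      simp [mul_comm]
    rw [this]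
    exact sum_mem fun j _ ↦ smul_mem _ _ (subset_span ⟨j, rfl⟩)
  rw [Subspace.dual_finrank_eq] at h
  obtain ⟨f, a, ha, hf⟩ := h
  refine ⟨f, a, ha, fun w hw j ↦ ?_⟩
  simpa using LinearMap.congr_fun (hf j) ⟨w, hw⟩

/-- A set with differences in `U` and coordinates in sets of size at most `m` has at most
`m ^ dim U` elements. -/
lemma ncard_le_pow_finrank {d m : ℕ} {U : Submodule ℝ (Fin d → ℝ)} {A : Set (Fin d → ℝ)}
    (hA : ∀ a ∈ A, ∀ b ∈ A, a - b ∈ U) (S : Fin d → Finset ℝ) (hS : ∀ j, (S j).card ≤ m)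
    (hAS : ∀ a ∈ A, ∀ j, a j ∈ S j) : A.ncard ≤ m ^ Module.finrank ℝ U := by
  classical
  obtain ⟨f, a, -, hf⟩ := U.exists_coord_graph
  have hle : A.ncard ≤
      (↑(Fintype.piFinset fun i ↦ S (f i)) : Set (Fin (Module.finrank ℝ U) → ℝ)).ncard := by
    refine ncard_le_ncard_of_injOn (fun z i ↦ z (f i)) (fun z hz ↦ ?_) (fun y hy z hz hyz ↦ ?_)
      (Finset.finite_toSet _)
    · simpa using fun i ↦ hAS z hz (f i)
    · ext j
      have h := hf _ (hA y hy z hz) j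
      have h0 : ∀ i, (y - z) (f i) = 0 := fun i ↦ sub_eq_zero.2 (congr_fun hyz i)
      simp only [h0, mul_zero, Finset.sum_const_zero] at h
      exact sub_eq_zero.1 h
  rw [ncard_coe_finset, Fintype.card_piFinset] at hle
  refine hle.trans ((Finset.prod_le_pow_card _ _ m fun i _ ↦ hS _).trans ?_)
  simp

/-- The integers of absolute value at most `K`, as real numbers. -/
def intBox (K : ℕ) : Finset ℝ :=
  (Finset.Icc (-K : ℤ) K).image (fun a : ℤ ↦ (a : ℝ))

lemma mem_intBox {K : ℕ} {r : ℝ} : r ∈ intBox K ↔ ∃ a : ℤ, |a| ≤ K ∧ (a : ℝ) = r := by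
  simp [intBox, abs_le]

lemma card_intBox_le (K : ℕ) : (intBox K).card ≤ 2 * K + 1 := by
  refine Finset.card_image_le.trans ?_
  simp
  omega

lemma gridD_finite (n d : ℕ) : (gridD n d).Finite := by
  classical
  refine (Finset.finite_toSet (Fintype.piFinset fun _ : Fin d ↦ intBox n)).subset fun x hx ↦ ?_
  simp only [Finset.mem_coe, Fintype.mem_piFinset, mem_intBox]
  intro i
  obtain ⟨a, h1, h2, h3⟩ := hx i
  exact ⟨a, abs_le.2 ⟨by omega, h2⟩, h3.symm⟩

/-- An affine subspace of dimension `t` has at most `n ^ t` points in the grid. -/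
lemma ncard_inter_gridD_le {n d t : ℕ} {P : AffineSubspace ℝ (Fin d → ℝ)}
    (hP : IsAffineOfDim d t P) : ((P : Set (Fin d → ℝ)) ∩ gridD n d).ncard ≤ n ^ t := by
  classical
  rw [← hP]
  refine ncard_le_pow_finrank (fun a ha b hb ↦ AffineSubspace.vsub_mem_direction ha.1 hb.1)
    (fun _ ↦ (Finset.Icc (1 : ℤ) n).image (fun a : ℤ ↦ (a : ℝ))) (fun j ↦ ?_) fun z hz j ↦ ?_
  · exact Finset.card_image_le.trans (by simp)
  · obtain ⟨a, h1, h2, h3⟩ := hz.2 j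
    exact Finset.mem_image.2 ⟨a, Finset.mem_Icc.2 ⟨h1, h2⟩, h3.symm⟩

/-- The span of the integer vectors of sup norm at most `K` in `W`. -/
def shortSpan {d : ℕ} (K : ℕ) (W : Submodule ℝ (Fin d → ℝ)) : Submodule ℝ (Fin d → ℝ) :=
  Submodule.span ℝ {w | w ∈ W ∧ ∀ j, w j ∈ intBox K}

lemma shortSpan_le {d : ℕ} (K : ℕ) (W : Submodule ℝ (Fin d → ℝ)) : shortSpan K W ≤ W :=
  Submodule.span_le.2 fun _ h ↦ h.1

/-- The space `shortSpan K W` is spanned by `d` integer vectors of sup norm at most `K`. -/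
lemma shortSpan_eq_span_range {d : ℕ} (K : ℕ) (W : Submodule ℝ (Fin d → ℝ)) :
    ∃ M : Fin d → Fin d → intBox K,
      shortSpan K W = Submodule.span ℝ (range fun i j ↦ (M i j : ℝ)) := by
  obtain ⟨g, hg, hspan, -⟩ :=
    Submodule.exists_fun_fin_finrank_span_eq ℝ {w : Fin d → ℝ | w ∈ W ∧ ∀ j, w j ∈ intBox K}
  have hs : Module.finrank ℝ
      (Submodule.span ℝ {w : Fin d → ℝ | w ∈ W ∧ ∀ j, w j ∈ intBox K}) ≤ d :=
    (Submodule.finrank_le _).trans (by simp)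
  have h0 : (0 : ℝ) ∈ intBox K := mem_intBox.2 ⟨0, by simp, by simp⟩
  rw [shortSpan, ← hspan]
  clear hspan
  generalize Module.finrank ℝ
    (Submodule.span ℝ {w : Fin d → ℝ | w ∈ W ∧ ∀ j, w j ∈ intBox K}) = s at g hg hs
  refine ⟨fun i j ↦ if h : (i : ℕ) < s then ⟨g ⟨i, h⟩ j, (hg _).2 j⟩ else ⟨0, h0⟩, ?_⟩
  apply le_antisymm <;> rw [Submodule.span_le]
  · rintro _ ⟨i, rfl⟩
    refine Submodule.subset_span ⟨⟨i, i.2.trans_le hs⟩, ?_⟩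
    simp
  · rintro _ ⟨i, rfl⟩
    by_cases h : (i : ℕ) < s
    · refine Submodule.subset_span ⟨⟨i, h⟩, ?_⟩
      simp [h]
    · simp only [h, dite_false]
      exact Submodule.zero_mem _

lemma sub_mem_shortSpan {n d K : ℕ} {W : Submodule ℝ (Fin d → ℝ)} {x y : Fin d → ℝ}
    (hx : x ∈ gridD n d) (hy : y ∈ gridD n d) (hW : x - y ∈ W) (hK : ∀ j, |x j - y j| ≤ K) :
    x - y ∈ shortSpan K W := by
  refine Submodule.subset_span ⟨hW, fun j ↦ ?_⟩
  obtain ⟨a, -, -, ha⟩ := hx j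
  obtain ⟨b, -, -, hb⟩ := hy j
  have h := hK j
  refine mem_intBox.2 ⟨a - b, ?_, by simp [ha, hb]⟩
  rw [ha, hb] at h
  exact_mod_cast h

/-- The affine subspace `P` meets few boxes of side `L`, and the grid points of `P` in each box lie
in a translate of the span of the short integer vectors in the direction of `P`. -/
lemma ncard_inter_gridD_le_mul {n d t L : ℕ} (hL : 0 < L) {P : AffineSubspace ℝ (Fin d → ℝ)}
    (hP : IsAffineOfDim d t P) :
    ((P : Set (Fin d → ℝ)) ∩ gridD n d).ncard ≤
      (2 * (d * L) + 1) ^ Module.finrank ℝ (shortSpan (d * L) P.direction) * (n / L + 1) ^ t := by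
  classical
  rw [← hP]
  obtain ⟨f, a, ha, hf⟩ := P.direction.exists_coord_graph
  have hd : Module.finrank ℝ P.direction ≤ d := (Submodule.finrank_le _).trans (by simp)
  have hfin : ((P : Set (Fin d → ℝ)) ∩ gridD n d).Finite := (gridD_finite n d).inter_of_right _
  have key := Finset.card_le_mul_card_image_of_maps_to (s := hfin.toFinset)
    (f := fun z i ↦ ⌊z (f i)⌋₊ / L)
    (t := Fintype.piFinset fun _ : Fin (Module.finrank ℝ P.direction) ↦ Finset.range (n / L + 1))
    ?_ ((2 * (d * L) + 1) ^ Module.finrank ℝ (shortSpan (d * L) P.direction)) ?_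
  · rw [Fintype.card_piFinset, Finset.prod_const, Finset.card_univ, Fintype.card_fin,
      Finset.card_range] at key
    rwa [ncard_eq_toFinset_card _ hfin]
  · intro z hz
    rw [Finite.mem_toFinset] at hz
    refine Fintype.mem_piFinset.2 fun i ↦ Finset.mem_range.2 (Nat.lt_succ_of_le ?_)
    refine Nat.div_le_div_right ?_
    obtain ⟨b, h1, h2, h3⟩ := hz.2 (f i)
    rw [h3]
    exact Nat.floor_le_of_le (by exact_mod_cast h2)
  · intro c _
    rw [← ncard_coe_finset]
    obtain hem | ⟨p, hp⟩ := Set.eq_empty_or_nonempty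
      (({z ∈ hfin.toFinset | (fun i ↦ ⌊z (f i)⌋₊ / L) = c} : Finset _) : Set (Fin d → ℝ))
    · rw [hem]; simp
    have hclose : ∀ y ∈ P, ∀ z ∈ P, y ∈ gridD n d → z ∈ gridD n d →
        (fun i ↦ ⌊y (f i)⌋₊ / L) = (fun i ↦ ⌊z (f i)⌋₊ / L) → ∀ j, |y j - z j| ≤ (d * L : ℕ) := by
      intro y hyP z hzP hy hz hyz j
      have h := hf _ (AffineSubspace.vsub_mem_direction hyP hzP) j
      simp only [vsub_eq_sub, Pi.sub_apply] at h
      rw [h]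
      calc |∑ i, a j i * (y (f i) - z (f i))| ≤ ∑ i, |a j i * (y (f i) - z (f i))| :=
            Finset.abs_sum_le_sum_abs _ _
        _ ≤ ∑ _i : Fin (Module.finrank ℝ P.direction), (L : ℝ) := by
            refine Finset.sum_le_sum fun i _ ↦ ?_
            rw [abs_mul]
            refine (mul_le_of_le_one_left (abs_nonneg _) (ha j i)).trans ?_
            obtain ⟨b, hb, -, hyb⟩ := hy (f i)
            obtain ⟨b', hb', -, hzb⟩ := hz (f i)
            lift b to ℕ using by omega
            lift b' to ℕ using by omega
            have hq := congr_fun hyz i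
            simp only [hyb, hzb, Int.cast_natCast, Nat.floor_natCast] at hq
            rw [hyb, hzb]
            have : |(b : ℤ) - b'| ≤ L := by
              have h1 := Nat.div_add_mod b L
              have h2 := Nat.div_add_mod b' L
              have h3 := Nat.mod_lt b hL
              have h4 := Nat.mod_lt b' hL
              rw [hq] at h1
              rw [abs_le]
              omega
            exact_mod_cast this
        _ ≤ (d * L : ℕ) := by
            simp only [Finset.sum_const, Finset.card_univ, Fintype.card_fin, nsmul_eq_mul]
            push_cast
            gcongr
    simp only [Finset.coe_filter, Finite.mem_toFinset, mem_ofPred_eq] at hp ⊢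
    refine ncard_le_pow_finrank (fun y hy z hz ↦ ?_)
      (fun j ↦ (intBox (d * L)).image (· + p j))
      (fun j ↦ Finset.card_image_le.trans (card_intBox_le _)) fun y hy j ↦ ?_
    · exact sub_mem_shortSpan hy.1.2 hz.1.2 (AffineSubspace.vsub_mem_direction hy.1.1 hz.1.1)
        (hclose y hy.1.1 z hz.1.1 hy.1.2 hz.1.2 (hy.2.trans hz.2.symm))
    · have h := hclose y hy.1.1 p hp.1.1 hy.1.2 hp.1.2 (hy.2.trans hp.2.symm) j
      obtain ⟨b, -, -, hb⟩ := hy.1.2 j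
      obtain ⟨b', -, -, hb'⟩ := hp.1.2 j
      refine Finset.mem_image.2 ⟨b - b', mem_intBox.2 ⟨b - b', ?_, by push_cast; rfl⟩, ?_⟩
      · rw [hb, hb'] at h
        exact_mod_cast h
      · rw [hb, hb']; ring

/-- An affine subspace with many grid points has the same grid points as the subspace spanned at one
of them by the short integer vectors in its direction. -/
lemma inter_gridD_eq_of_le_ncard {n d t L : ℕ} (ht : 1 ≤ t) (htd : t ≤ d) {α : ℝ}
    (hL : ((6 * d) ^ d : ℝ) < α * L) {P : AffineSubspace ℝ (Fin d → ℝ)}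
    (hP : IsAffineOfDim d t P) {x : Fin d → ℝ} (hx : x ∈ gridD n d) (hxP : x ∈ P)
    (hcard : α ≤ (((P : Set (Fin d → ℝ)) ∩ gridD n d).ncard : ℝ) / (n : ℝ) ^ t) :
    (P : Set (Fin d → ℝ)) ∩ gridD n d =
      {y | y - x ∈ shortSpan (d * L) P.direction} ∩ gridD n d := by
  have hd : 1 ≤ d := ht.trans htd
  have hL0 : 0 < L := by
    rcases Nat.eq_zero_or_pos L with rfl | h
    · have : (0 : ℝ) ≤ (6 * d) ^ d := by positivity
      simp at hL
      linarith
    · exact h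
  ext y
  refine and_congr_left fun hy ↦ ⟨fun hyP ↦ ?_, fun h ↦ ?_⟩
  swap
  · have := AffineSubspace.vadd_mem_of_mem_direction (shortSpan_le _ _ h) hxP
    simpa using this
  have hdir : y - x ∈ P.direction := AffineSubspace.vsub_mem_direction hyP hxP
  change y - x ∈ shortSpan (d * L) P.direction
  rcases lt_or_ge n L with hn | hn
  · refine sub_mem_shortSpan hy hx hdir fun j ↦ ?_
    obtain ⟨b, h1, h2, hb⟩ := hy j
    obtain ⟨b', h3, h4, hb'⟩ := hx j
    have h5 : L ≤ d * L := Nat.le_mul_of_pos_left _ hd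
    rw [hb, hb']
    have : |b - b'| ≤ ((d * L : ℕ) : ℤ) := by
      rw [abs_le]
      generalize d * L = K at h5
      omega
    exact_mod_cast this
  · suffices h : shortSpan (d * L) P.direction = P.direction by rwa [h]
    by_contra hne
    have hlt : Module.finrank ℝ (shortSpan (d * L) P.direction) < t :=
      hP ▸ Submodule.finrank_lt_finrank_of_lt (lt_of_le_of_ne (shortSpan_le _ _) hne)
    have hn0 : (0 : ℝ) < n := by exact_mod_cast hL0.trans_le hn
    have hL0' : (0 : ℝ) < L := by exact_mod_cast hL0
    have hd' : (1 : ℝ) ≤ d := by exact_mod_cast hd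
    have hL1 : (1 : ℝ) ≤ L := by exact_mod_cast hL0
    have hdL : (1 : ℝ) ≤ d * L := one_le_mul_of_one_le_of_one_le hd' hL1
    have hc : (((P : Set (Fin d → ℝ)) ∩ gridD n d).ncard : ℝ) ≤
        (3 * (d * L)) ^ (t - 1) * (2 * (n / L)) ^ t := by
      have h := ncard_inter_gridD_le_mul (n := n) hL0 hP
      have h' : (((P : Set (Fin d → ℝ)) ∩ gridD n d).ncard : ℝ) ≤
        (2 * (d * L) + 1) ^ Module.finrank ℝ (shortSpan (d * L) P.direction) *
          ((n / L : ℕ) + 1) ^ t := by exact_mod_cast h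
      refine h'.trans ?_
      gcongr ?_ * ?_
      · calc (2 * (d * L) + 1 : ℝ) ^ Module.finrank ℝ (shortSpan (d * L) P.direction)
            ≤ (2 * (d * L) + 1 : ℝ) ^ (t - 1) :=
              pow_le_pow_right₀ (by linarith) (Nat.le_sub_one_of_lt hlt)
          _ ≤ _ := by gcongr; linarith
      · gcongr
        have h1 : ((n / L : ℕ) : ℝ) ≤ n / L := Nat.cast_div_le
        have h2 : (1 : ℝ) ≤ n / L := (one_le_div hL0').2 (by exact_mod_cast hn)
        linarith
    rw [le_div_iff₀ (by positivity)] at hcard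
    have h1 : α * L * n ^ t ≤ (6 * d) ^ d * n ^ t := by
      calc α * L * n ^ t = (α * n ^ t) * L := by ring
        _ ≤ (3 * (d * L)) ^ (t - 1) * (2 * (n / L)) ^ t * L := by
            exact mul_le_mul_of_nonneg_right (hcard.trans hc) hL0'.le
        _ ≤ (3 * d) ^ (t - 1) * 2 ^ t * n ^ t := by
            obtain ⟨s, rfl⟩ : ∃ s, t = s + 1 := ⟨t - 1, by omega⟩
            apply le_of_eq
            simp only [Nat.add_sub_cancel]
            simp only [mul_pow, div_pow]
            field_simp
            ring
        _ ≤ (3 * d) ^ d * 2 ^ d * n ^ t := by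
            gcongr
            · linarith
            · omega
            · norm_num
        _ = (6 * d) ^ d * n ^ t := by rw [← mul_pow]; ring_nf
    have h2 := le_of_mul_le_mul_right h1 (by positivity)
    linarith

/-- For every `d` there is a constant `C = C(d)` such that for all integers
`n, t` with `1 ≤ t ≤ d-1`, the hypergraph `𝓗_{n,d,t}` on vertex set `[n]^d` whose edges are the
sets `F = F' ∩ [n]^d` for `t`-dimensional affine subspaces `F'` of `ℝ^d` has polynomial tails
with parameters `N = n^t` and `C`: every edge has at most `n^t` vertices and, for every
`x ∈ [n]^d` and `α ∈ (0,1]`, the number of edges `F` with `x ∈ F` and `|F|/n^t ≥ α` is at most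
`C α^{-C}`. -/
theorem grid_hypergraph_polynomial_tails (d : ℕ) (hd : 2 ≤ d) :
    ∃ C : ℕ, ∀ n t : ℕ, 1 ≤ t → t ≤ d - 1 →
      (∀ F : Set (Fin d → ℝ),
        (∃ F' : AffineSubspace ℝ (Fin d → ℝ), IsAffineOfDim d t F' ∧
          F = (F' : Set (Fin d → ℝ)) ∩ gridD n d) →
        F.ncard ≤ n ^ t) ∧
      (∀ x ∈ gridD n d, ∀ α : ℝ, 0 < α → α ≤ 1 →
        (({F : Set (Fin d → ℝ) |
            (∃ F' : AffineSubspace ℝ (Fin d → ℝ), IsAffineOfDim d t F' ∧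
              F = (F' : Set (Fin d → ℝ)) ∩ gridD n d) ∧
            x ∈ F ∧ α ≤ (F.ncard : ℝ) / (n : ℝ) ^ t}).ncard : ℝ) ≤ (C : ℝ) * α⁻¹ ^ C) := by
  refine ⟨((6 * d) ^ (d + 1)) ^ (d * d) + d * d, fun n t ht htd ↦ ⟨?_, fun x hx α hα hα1 ↦ ?_⟩⟩
  · rintro F ⟨P, hP, rfl⟩
    exact ncard_inter_gridD_le hP
  set L := ⌊((6 * d) ^ d : ℝ) / α⌋₊ + 1 with hLdef
  have hL : ((6 * d) ^ d : ℝ) < α * L := by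
    rw [mul_comm α, ← div_lt_iff₀ hα, hLdef]
    exact_mod_cast Nat.lt_floor_add_one _
  have hcount : ({F : Set (Fin d → ℝ) |
      (∃ F' : AffineSubspace ℝ (Fin d → ℝ), IsAffineOfDim d t F' ∧
        F = (F' : Set (Fin d → ℝ)) ∩ gridD n d) ∧
      x ∈ F ∧ α ≤ (F.ncard : ℝ) / (n : ℝ) ^ t}).ncard ≤ (2 * (d * L) + 1) ^ (d * d) := by
    let φ : (Fin d → Fin d → intBox (d * L)) → Set (Fin d → ℝ) := fun M ↦
      {y | y - x ∈ Submodule.span ℝ (range fun i j ↦ (M i j : ℝ))} ∩ gridD n d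
    have hsub : {F : Set (Fin d → ℝ) |
        (∃ F' : AffineSubspace ℝ (Fin d → ℝ), IsAffineOfDim d t F' ∧
          F = (F' : Set (Fin d → ℝ)) ∩ gridD n d) ∧
        x ∈ F ∧ α ≤ (F.ncard : ℝ) / (n : ℝ) ^ t} ⊆ φ '' univ := by
      rintro _ ⟨⟨P, hP, rfl⟩, hxP, hc⟩
      obtain ⟨M, hM⟩ := shortSpan_eq_span_range (d * L) P.direction
      refine ⟨M, trivial, ?_⟩
      rw [inter_gridD_eq_of_le_ncard ht (by omega) hL hP hx hxP.1 hc, hM]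
    refine (ncard_le_ncard hsub (finite_univ.image φ)).trans ((ncard_image_le finite_univ).trans ?_)
    rw [ncard_univ, Nat.card_eq_fintype_card]
    simp only [Fintype.card_pi, Fintype.card_coe, Finset.prod_const, Finset.card_univ,
      Fintype.card_fin, ← pow_mul]
    exact Nat.pow_le_pow_left (card_intBox_le _) _
  have hd1 : (2 : ℝ) ≤ d := by exact_mod_cast hd
  have hinv : 1 ≤ α⁻¹ := (one_le_inv₀ hα).2 hα1
  have hpow : (1 : ℝ) ≤ (6 * d) ^ d := one_le_pow₀ (by linarith)
  have hQ : 1 ≤ ((6 * d) ^ d : ℝ) * α⁻¹ := one_le_mul_of_one_le_of_one_le hpow hinv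
  have hbase : (2 * (d * L) + 1 : ℝ) ≤ (6 * d) ^ (d + 1) * α⁻¹ := by
    have hfl : (L : ℝ) ≤ (6 * d) ^ d * α⁻¹ + 1 := by
      rw [hLdef, ← div_eq_mul_inv]
      push_cast
      gcongr
      exact Nat.floor_le (by positivity)
    have hL2 : (L : ℝ) ≤ 2 * ((6 * d) ^ d * α⁻¹) := by linarith
    have hL1 : (1 : ℝ) ≤ L := by exact_mod_cast Nat.succ_le_succ (Nat.zero_le _)
    have hdL : (1 : ℝ) ≤ d * L := one_le_mul_of_one_le_of_one_le (by linarith) hL1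
    calc (2 * (d * L) + 1 : ℝ) ≤ 3 * d * L := by linarith
      _ ≤ 3 * d * (2 * ((6 * d) ^ d * α⁻¹)) := by gcongr
      _ = _ := by ring
  calc _ ≤ (((2 * (d * L) + 1) ^ (d * d) : ℕ) : ℝ) := by exact_mod_cast hcount
    _ = (2 * (d * L) + 1 : ℝ) ^ (d * d) := by push_cast; rfl
    _ ≤ ((6 * d) ^ (d + 1) * α⁻¹) ^ (d * d) := by gcongr
    _ = ((6 * d) ^ (d + 1)) ^ (d * d) * α⁻¹ ^ (d * d) := mul_pow _ _ _
    _ ≤ _ := by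
      push_cast
      gcongr
      · exact le_add_of_nonneg_right (by positivity)
      · omega
end
end
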